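/- Fix d ≥ 2. There exists a constant C > 0 depending only on the dimension d such that for all n large enough (so that the parameter below is nonnegative) and all finite sets S, T ⊆ ℤ^d with B[n] ⊆ S ⊆ T, the set A_1(T) obtained by adding one uIDLA particle to T stochastically dominates DA_δ(S), where δ is a Bernoulli random variable with parameter (b_n/|T|)(1 − C/n). -/

import Mathlib

open MeasureTheory Filter
open scoped ENNReal

noncomputable section

/-- The `k`-th binary digit of `x ∈ [0,1)` (after the binary point). -/
def bit (x : ℝ) (k : ℕ) : Bool := ⌊x * 2 ^ (k + 1)⌋ % 2 == 1

/-- From one uniform sample on `[0,1]`, extract countably many independent uniform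
samples on `[0,1]`, using disjoint subsequences of binary digits. -/
def uSlice (x : ℝ) (i : ℕ) : ℝ :=
  ∑' j : ℕ, if bit x (Nat.pair i j) then ((2 : ℝ) ^ (-(j : ℤ) - 1)) else 0

/-- The base probability space: Lebesgue measure restricted to `[0,1]`. -/
def μ0 : Measure ℝ := volume.restrict (Set.Icc 0 1)

/-- The vertex set of the lattice `ℤ^d`. -/
abbrev V (d : ℕ) := Fin d → ℤ

instance (d : ℕ) : MeasurableSpace (Finset (V d)) := ⊤

open Classical in
/-- `B[r]`: the Euclidean ball of radius `r` in `ℤ^d`, as a `Finset`. -/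
def ball (d : ℕ) (r : ℝ) : Finset (V d) :=
  (Finset.Icc (fun _ => -⌈r⌉) (fun _ => ⌈r⌉)).filter
    (fun y => Real.sqrt (∑ i, ((y i : ℝ)) ^ 2) ≤ r)

/-- `b_n`: the number of lattice points in the Euclidean ball of radius `n`. -/
def bn (d n : ℕ) : ℕ := (ball d n).card

/-- The `2d` unit vectors of `ℤ^d` (the possible steps of the simple random walk). -/
def unitVecs (d : ℕ) : Finset (V d) :=
  Finset.image
    (fun p : Fin d × Bool => fun j => if j = p.1 then (if p.2 then 1 else -1) else 0)
    Finset.univ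

/-- Given `u` uniform on `[0,1]`, `pick S u` is a uniformly chosen element of `S`. -/
def pick {d : ℕ} (S : Finset (V d)) (u : ℝ) : V d :=
  if h : S.Nonempty then
    (S.equivFin.symm ⟨(⌊u * S.card⌋).toNat % S.card,
      Nat.mod_lt _ (Finset.card_pos.mpr h)⟩).val
  else 0

/-- Position at time `t` of the simple random walk started at `x`, driven by the
random seed `ω`: the steps `pick (unitVecs d) (uSlice ω i)` are i.i.d. uniform on
the `2d` unit vectors when `ω` is uniform on `[0,1]`. -/
def walk {d : ℕ} (x : V d) (ω : ℝ) (t : ℕ) : V d :=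
  x + ∑ i ∈ Finset.range t, pick (unitVecs d) (uSlice ω i)

/-- `t_S`: the first time the walk started at `x` is outside `S`. -/
def exitT {d : ℕ} (S : Finset (V d)) (x : V d) (ω : ℝ) : ℕ :=
  sInf {t | walk x ω t ∉ S}

/-- The position `ξ(t_S)` at which the walk started at `x` first exits `S`. -/
def hitPt {d : ℕ} (S : Finset (V d)) (x : V d) (ω : ℝ) : V d :=
  walk x ω (exitT S x ω)

/-- `Add[ξ,S]`: add to `S` the exit point of a random walk started at `x`. -/
def addPt {d : ℕ} (S : Finset (V d)) (x : V d) (ω : ℝ) : Finset (V d) :=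
  insert (hitPt S x ω) S

/-- `P_x(ξ(τ_A) = y)`: the probability that the walk started at `x` exits `A` at `y`. -/
def hitProb {d : ℕ} (A : Finset (V d)) (x y : V d) : ℝ≥0∞ :=
  μ0 {ω | hitPt A x ω = y}

/-- The outer boundary `∂A`: vertices outside `A` with a neighbour in `A`. -/
def outb {d : ℕ} (A : Finset (V d)) : Finset (V d) :=
  (A.biUnion fun x => (unitVecs d).image (fun e => x + e)) \ A

/-- `DA_X(S)`: the IDLA aggregate obtained from `S` by launching one particle from each
point of the list `xs` in turn (driven by independent slices of the seed `ω`). -/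
def daFrom {d : ℕ} : Finset (V d) → List (V d) → ℝ → Finset (V d)
  | S, [], _ => S
  | S, x :: xs, ω => daFrom (addPt S x (uSlice ω 0)) xs (uSlice ω 1)

/-- The law of the IDLA aggregate `DA_X(S)`. -/
def daLaw {d : ℕ} (S : Finset (V d)) (xs : List (V d)) : Measure (Finset (V d)) :=
  μ0.map (fun ω => daFrom S xs ω)

/-- One uIDLA step: launch a particle from a uniformly chosen point of `S`. -/
def uStep {d : ℕ} (S : Finset (V d)) (ω : ℝ) : Finset (V d) :=
  addPt S (pick S (uSlice ω 0)) (uSlice ω 1)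

/-- `A_k(S)`: the uIDLA aggregate obtained by adding `k` particles to `S`,
each started at a uniform point of the current aggregate. -/
def uAggFrom {d : ℕ} (S : Finset (V d)) (ω : ℝ) : ℕ → Finset (V d)
  | 0 => S
  | k + 1 => uStep (uAggFrom S ω k) (uSlice ω k)

/-- The law of the uIDLA aggregate `A_k(S)`. -/
def uLaw {d : ℕ} (S : Finset (V d)) (k : ℕ) : Measure (Finset (V d)) :=
  μ0.map (fun ω => uAggFrom S ω k)

/-- One step of the subset uIDLA `A_·(E;m)`: at step `k`, perform a uIDLA step
with probability `|E|/(m+k)` and otherwise do nothing. -/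
def subStep {d : ℕ} (m k : ℕ) (E : Finset (V d)) (ω : ℝ) : Finset (V d) :=
  if uSlice ω 0 * ((m : ℝ) + k) ≤ E.card then uStep E (uSlice ω 1) else E

/-- The subset uIDLA `A_n(E;m)`. -/
def subAggFrom {d : ℕ} (E : Finset (V d)) (m : ℕ) (ω : ℝ) : ℕ → Finset (V d)
  | 0 => E
  | k + 1 => subStep m k (subAggFrom E m ω k) (uSlice ω k)

/-- The law of the subset uIDLA `A_n(E;m)`. -/
def subLaw {d : ℕ} (E : Finset (V d)) (m k : ℕ) : Measure (Finset (V d)) :=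
  μ0.map (fun ω => subAggFrom E m ω k)

/-- Stochastic domination of random finite subsets of `ℤ^d`: `μ` dominates `ν` if
there is a coupling under which the sample of `ν` is a.s. contained in that of `μ`. -/
def StochDom {d : ℕ} (μ ν : Measure (Finset (V d))) : Prop :=
  ∃ π : Measure (Finset (V d) × Finset (V d)), IsProbabilityMeasure π ∧
    π.map Prod.fst = μ ∧ π.map Prod.snd = ν ∧ π {p | p.2 ⊆ p.1} = 1

/-- A `Geometric(1/2)` sample (taking value `j ≥ 0` with probability `2^{-(j+1)}`)
produced from a uniform sample `u` on `[0,1]` by inverting the CDF. -/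
def geom (u : ℝ) : ℕ := sInf {j : ℕ | u ≤ 1 - (2 : ℝ) ^ (-(j : ℤ) - 1)}

/-- The parent of vertex `j ≥ 1` in the uniform random recursive tree (vertex `0` is
the root): uniform on `{0, …, j-1}` when the seed is uniform on `[0,1]`. -/
def parent (ω : ℝ) (j : ℕ) : ℕ := (⌊uSlice ω (Nat.pair 0 j) * j⌋).toNat % j

/-- The reaching time of vertex `j` in a uniform random recursive tree whose edges
carry i.i.d. `Geometric(1/2)` weights: the sum of the weights on the path from the
root to `j`. (The `min` is a.s. inoperative, since a.s. `parent ω (j+1) ≤ j`.) -/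
def reach (ω : ℝ) : ℕ → ℕ
  | 0 => 0
  | j + 1 => reach ω (min (parent ω (j + 1)) j) + geom (uSlice ω (Nat.pair 1 (j + 1)))
termination_by j => j
decreasing_by exact Nat.lt_succ_of_le (min_le_right _ _)

end


namespace UIDLA

lemma nonneg_of_deriv {f f' : ℝ → ℝ} {T : ℝ}
    (hf : ∀ t ∈ Set.Icc 0 T, HasDerivAt f (f' t) t) (h0 : 0 ≤ f 0)
    (h' : ∀ t ∈ Set.Icc 0 T, 0 ≤ f' t) : ∀ t ∈ Set.Icc 0 T, 0 ≤ f t := by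
  intro t ht
  have hm : MonotoneOn f (Set.Icc 0 T) := by
    apply monotoneOn_of_deriv_nonneg (convex_Icc 0 T)
    · intro s hs; exact (hf s hs).continuousAt.continuousWithinAt
    · intro s hs; exact (hf s (interior_subset hs)).differentiableAt.differentiableWithinAt
    · intro s hs; rw [(hf s (interior_subset hs)).deriv]; exact h' s (interior_subset hs)
  exact h0.trans (hm ⟨le_refl _, ht.1.trans ht.2⟩ ht ht.1)

lemma symdiff_le {f f1 f2 : ℝ → ℝ} {Q T A B : ℝ}
    (h1 : ∀ M ∈ Set.Icc (Q - T) (Q + T), HasDerivAt f (f1 M) M)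
    (h2 : ∀ M ∈ Set.Icc (Q - T) (Q + T), HasDerivAt f1 (f2 M) M)
    (hb : ∀ t ∈ Set.Icc 0 T, f2 (Q + t) + f2 (Q - t) ≤ A + B * t ^ 2) :
    ∀ t ∈ Set.Icc 0 T, f (Q + t) + f (Q - t) - 2 * f Q ≤ A * t ^ 2 / 2 + B * t ^ 4 / 12 := by
  have m1 : ∀ t ∈ Set.Icc 0 T, Q + t ∈ Set.Icc (Q - T) (Q + T) := by
    intro t ht; constructor <;> linarith [ht.1, ht.2]
  have m2 : ∀ t ∈ Set.Icc 0 T, Q - t ∈ Set.Icc (Q - T) (Q + T) := by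
    intro t ht; constructor <;> linarith [ht.1, ht.2]
  have key : ∀ t ∈ Set.Icc 0 T,
      0 ≤ A * t ^ 2 / 2 + B * t ^ 4 / 12 - (f (Q + t) + f (Q - t) - 2 * f Q) := by
    apply nonneg_of_deriv (f' := fun t => A * t + B * t ^ 3 / 3 - (f1 (Q + t) - f1 (Q - t)))
    · intro t ht
      have e1 : HasDerivAt (fun t => f (Q + t)) (f1 (Q + t)) t := by
        simpa using (h1 _ (m1 t ht)).comp_const_add Q t
      have e2 : HasDerivAt (fun t => f (Q - t)) (-f1 (Q - t)) t := by
        simpa using (h1 _ (m2 t ht)).comp_const_sub Q t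
      have e3 : HasDerivAt (fun t : ℝ => A * t ^ 2 / 2 + B * t ^ 4 / 12)
          (A * t + B * t ^ 3 / 3) t := by
        have := (((hasDerivAt_pow 2 t).const_mul A).div_const 2).add
          (((hasDerivAt_pow 4 t).const_mul B).div_const 12)
        refine HasDerivAt.congr_deriv this ?_
        norm_num; ring
      have := e3.sub ((e1.add e2).sub_const (2 * f Q))
      refine HasDerivAt.congr_deriv this ?_
      ring
    · simp; linarith
    · apply nonneg_of_deriv (f' := fun t => A + B * t ^ 2 - (f2 (Q + t) + f2 (Q - t)))
      · intro t ht
        have e1 : HasDerivAt (fun t => f1 (Q + t)) (f2 (Q + t)) t := by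
          simpa using (h2 _ (m1 t ht)).comp_const_add Q t
        have e2 : HasDerivAt (fun t => f1 (Q - t)) (-f2 (Q - t)) t := by
          simpa using (h2 _ (m2 t ht)).comp_const_sub Q t
        have e3 : HasDerivAt (fun t : ℝ => A * t + B * t ^ 3 / 3)
            (A + B * t ^ 2) t := by
          have := ((hasDerivAt_id t).const_mul A).add
            (((hasDerivAt_pow 3 t).const_mul B).div_const 3)
          refine HasDerivAt.congr_deriv this ?_
          norm_num; ring
        have := e3.sub (e1.sub e2)
        refine HasDerivAt.congr_deriv this ?_
        ring
      · simp
      · intro t ht; have := hb t ht; linarith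
  intro t ht; have := key t ht; linarith

lemma exists_g (q : ℝ) : ∃ g : ℝ → ℝ, ∀ M : ℝ, 0 < M → HasDerivAt g (-(M ^ (-q))) M := by
  by_cases hq : q = 1
  · refine ⟨fun M => -Real.log M, fun M hM => ?_⟩
    have := (Real.hasDerivAt_log hM.ne').neg
    rw [hq, Real.rpow_neg_one]; exact this
  · refine ⟨fun M => M ^ (1 - q) / (q - 1), fun M hM => ?_⟩
    have := (Real.hasDerivAt_rpow_const (x := M) (p := 1 - q) (Or.inl hM.ne')).div_const (q - 1)
    refine HasDerivAt.congr_deriv this ?_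
    have h : q - 1 ≠ 0 := sub_ne_zero.mpr hq
    rw [show 1 - q - 1 = -q by ring]
    field_simp; ring

/-- a chosen primitive of `-M^{-q}` -/
noncomputable def gf (q : ℝ) : ℝ → ℝ := (exists_g q).choose

lemma gf_deriv (q : ℝ) {M : ℝ} (hM : 0 < M) : HasDerivAt (gf q) (-(M ^ (-q))) M :=
  (exists_g q).choose_spec M hM

lemma rp_deriv (p : ℝ) {M : ℝ} (hM : 0 < M) :
    HasDerivAt (fun M : ℝ => M ^ (-p)) (-p * M ^ (-(p + 1))) M := by
  have := Real.hasDerivAt_rpow_const (x := M) (p := -p) (Or.inl hM.ne')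
  rw [show -p - 1 = -(p + 1) by ring] at this
  exact this

lemma rp_anti {p x y : ℝ} (hp : 0 ≤ p) (hx : 0 < x) (hxy : x ≤ y) : y ^ (-p) ≤ x ^ (-p) :=
  Real.rpow_le_rpow_of_nonpos hx hxy (by linarith)

lemma half_rp {p Q : ℝ} (hQ : 0 < Q) : (Q / 2) ^ (-p) = 2 ^ p * Q ^ (-p) := by
  rw [Real.div_rpow hQ.le (by norm_num), Real.rpow_neg (by norm_num : (0:ℝ) ≤ 2)]
  field_simp

/-- tangent-line inequality from the mean value theorem -/
lemma mvt {f f' : ℝ → ℝ} {x y : ℝ} (hxy : x < y)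
    (h : ∀ M ∈ Set.Icc x y, HasDerivAt f (f' M) M) :
    ∃ c ∈ Set.Ioo x y, f y - f x = f' c * (y - x) := by
  obtain ⟨c, hc, h'⟩ := exists_hasDerivAt_eq_slope f f' hxy
    (fun M hM => (h M hM).continuousAt.continuousWithinAt)
    (fun M hM => h M (Set.Ioo_subset_Icc_self hM))
  refine ⟨c, hc, ?_⟩
  rw [h', div_mul_cancel₀]; linarith

lemma gf_step_le {q Q : ℝ} (hq : 0 ≤ q) (hQ : 1 < Q) : gf q Q - gf q (Q - 1) ≤ -(Q ^ (-q)) := by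
  obtain ⟨c, hc, h⟩ := mvt (f := gf q) (f' := fun M => -(M ^ (-q))) (x := Q - 1) (y := Q)
    (by linarith) (fun M hM => gf_deriv q (by linarith [hM.1]))
  have := rp_anti hq (show 0 < c by linarith [hc.1]) hc.2.le
  rw [h]; simp; exact this

lemma gf_step_ge {q Q : ℝ} (hq : 0 ≤ q) (hQ : 2 ≤ Q) :
    -(Q ^ (-q)) - q * 2 ^ (q + 1) * Q ^ (-(q + 1)) ≤ gf q Q - gf q (Q - 1) := by
  obtain ⟨c, hc, h⟩ := mvt (f := gf q) (f' := fun M => -(M ^ (-q))) (x := Q - 1) (y := Q)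
    (by linarith) (fun M hM => gf_deriv q (by linarith [hM.1]))
  obtain ⟨c', hc', h'⟩ := mvt (f := fun M : ℝ => M ^ (-q)) (f' := fun M => -q * M ^ (-(q + 1)))
    (x := c) (y := Q) hc.2 (fun M hM => rp_deriv q (by linarith [hM.1, hc.1]))
  have h1 : c' ^ (-(q + 1)) ≤ 2 ^ (q + 1) * Q ^ (-(q + 1)) := by
    rw [← half_rp (by linarith)]
    exact rp_anti (by linarith) (by linarith) (by linarith [hc'.1, hc.1])
  have h0 : 0 ≤ c' ^ (-(q + 1)) := Real.rpow_nonneg (by linarith [hc'.1, hc.1]) _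
  have h2 : q * c' ^ (-(q + 1)) * (Q - c) ≤ q * (2 ^ (q + 1) * Q ^ (-(q + 1))) * 1 := by
    apply mul_le_mul (mul_le_mul_of_nonneg_left h1 hq) (by linarith [hc.1]) (by linarith [hc.2])
    exact mul_nonneg hq (h0.trans h1)
  rw [h]; linarith

lemma gf_sym_ge {q Q t : ℝ} (hq : 0 ≤ q) (ht : |t| ≤ Q / 2) (hQ : 0 < Q) :
    q * Q ^ (-(q + 1)) * t ^ 2 ≤ gf q (Q + t) + gf q (Q - t) - 2 * gf q Q := by
  have hpos : ∀ M ∈ Set.Icc (Q - Q / 2) (Q + Q / 2), 0 < M := fun M hM => by linarith [hM.1]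
  have key := symdiff_le (f := fun M => - gf q M) (f1 := fun M => M ^ (-q))
    (f2 := fun M => -q * M ^ (-(q + 1))) (Q := Q) (T := Q / 2) (A := - 2 * q * Q ^ (-(q + 1)))
    (B := 0) (fun M hM => HasDerivAt.congr_deriv (gf_deriv q (hpos M hM)).neg (by simp))
    (fun M hM => rp_deriv q (hpos M hM)) ?_
  · have h1 : |t| ∈ Set.Icc 0 (Q / 2) := ⟨abs_nonneg t, ht⟩
    have := key |t| h1
    simp only [sq_abs] at this
    rcases abs_cases t with ⟨h, _⟩ | ⟨h, _⟩ <;> rw [h] at this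
    · nlinarith
    · rw [show Q - -t = Q + t by ring, show Q + -t = Q - t by ring] at this; nlinarith
  · intro t ht
    have := symdiff_le (f := fun M : ℝ => -q * M ^ (-(q + 1)))
      (f1 := fun M => -q * (-(q + 1) * M ^ (-(q + 1 + 1))))
      (f2 := fun M => -q * (-(q + 1) * (-(q + 1 + 1) * M ^ (-(q + 1 + 1 + 1)))))
      (Q := Q) (T := Q / 2) (A := 0) (B := 0)
      (fun M hM => (rp_deriv _ (hpos M hM)).const_mul (-q))
      (fun M hM => ((rp_deriv _ (hpos M hM)).const_mul _).const_mul (-q)) ?_ t ht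
    · linarith
    · intro t ht
      have b : ∀ M, Q / 2 ≤ M →
          -q * (-(q + 1) * (-(q + 1 + 1) * M ^ (-(q + 1 + 1 + 1)))) ≤ 0 := by
        intro M hM
        have : 0 ≤ q * ((q + 1) * ((q + 1 + 1) * M ^ (-(q + 1 + 1 + 1)))) := by
          have : 0 ≤ M := by linarith
          positivity
        linarith
      have h1 := b (Q + t) (by linarith [ht.1, ht.2])
      have h2 := b (Q - t) (by linarith [ht.1, ht.2])
      linarith

lemma gf_sym_le {q Q t : ℝ} (hq : 0 ≤ q) (ht : |t| ≤ Q / 2) (hQ : 0 < Q) :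
    gf q (Q + t) + gf q (Q - t) - 2 * gf q Q ≤ q * Q ^ (-(q + 1)) * t ^ 2
      + q * (q + 1) * (q + 2) * 2 ^ (q + 3) * Q ^ (-(q + 3)) * t ^ 4 := by
  have hpos : ∀ M ∈ Set.Icc (Q - Q / 2) (Q + Q / 2), 0 < M := fun M hM => by linarith [hM.1]
  set K := q * (q + 1) * (q + 2) * (2 ^ (q + 3) * Q ^ (-(q + 3))) with hK
  have hK0 : 0 ≤ K := by positivity
  have key := symdiff_le (f := gf q) (f1 := fun M => -(M ^ (-q)))
    (f2 := fun M => q * M ^ (-(q + 1))) (Q := Q) (T := Q / 2) (A := 2 * (q * Q ^ (-(q + 1))))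
    (B := K) (fun M hM => (gf_deriv q (hpos M hM)))
    (fun M hM => HasDerivAt.congr_deriv (rp_deriv q (hpos M hM)).neg (by simp)) ?_
  · have h1 : |t| ∈ Set.Icc 0 (Q / 2) := ⟨abs_nonneg t, ht⟩
    have := key |t| h1
    have h4 : 0 ≤ K * t ^ 4 := by positivity
    have e4 : |t| ^ 4 = t ^ 4 := by
      rw [show (4:ℕ) = 2 * 2 by norm_num, pow_mul, pow_mul, sq_abs]
    have hKe : q * (q + 1) * (q + 2) * 2 ^ (q + 3) * Q ^ (-(q + 3)) = K := by rw [hK]; ring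
    rw [hKe]
    rw [e4, sq_abs] at this
    rcases abs_cases t with ⟨h, _⟩ | ⟨h, _⟩ <;> rw [h] at this
    · linarith
    · rw [show Q - -t = Q + t by ring, show Q + -t = Q - t by ring] at this; linarith
  · intro t ht
    have := symdiff_le (f := fun M : ℝ => q * M ^ (-(q + 1)))
      (f1 := fun M => q * (-(q + 1) * M ^ (-(q + 1 + 1))))
      (f2 := fun M => q * (-(q + 1) * (-(q + 1 + 1) * M ^ (-(q + 1 + 1 + 1)))))
      (Q := Q) (T := Q / 2) (A := 2 * K) (B := 0)
      (fun M hM => (rp_deriv _ (hpos M hM)).const_mul q)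
      (fun M hM => ((rp_deriv _ (hpos M hM)).const_mul _).const_mul q) ?_ t ht
    · linarith
    · intro t ht
      have b : ∀ M, Q / 2 ≤ M → q * (-(q + 1) * (-(q + 1 + 1) * M ^ (-(q + 1 + 1 + 1)))) ≤ K := by
        intro M hM
        have : M ^ (-(q + 3)) ≤ 2 ^ (q + 3) * Q ^ (-(q + 3)) := by
          rw [← half_rp hQ]; exact rp_anti (by linarith) (by linarith) hM
        rw [hK, show q + 1 + 1 + 1 = q + 3 by ring,
          show q * (-(q + 1) * (-(q + 1 + 1) * M ^ (-(q + 3)))) =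
            q * (q + 1) * (q + 2) * M ^ (-(q + 3)) by ring]
        exact mul_le_mul_of_nonneg_left this (by positivity)
      have h1 := b (Q + t) (by linarith [ht.1, ht.2])
      have h2 := b (Q - t) (by linarith [ht.1, ht.2])
      linarith

end UIDLA


namespace UIDLA

variable {d : ℕ}

/-- squared Euclidean norm -/
noncomputable def nq (x : V d) : ℝ := ∑ i, (x i : ℝ) ^ 2

/-- unit coordinate vector -/
def sv (i : Fin d) : V d := Pi.single i 1

/-- (unnormalised) discrete Laplacian -/
noncomputable def L (f : V d → ℝ) (x : V d) : ℝ :=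
  ∑ i, (f (x + sv i) + f (x - sv i) - 2 * f x)

lemma nq_nonneg (x : V d) : 0 ≤ nq x := Finset.sum_nonneg fun _ _ => sq_nonneg _

lemma nq_zero : nq (0 : V d) = 0 := by simp [nq]

lemma sq_le_nq (x : V d) (i : Fin d) : (x i : ℝ) ^ 2 ≤ nq x :=
  Finset.single_le_sum (f := fun i => (x i : ℝ) ^ 2) (fun _ _ => sq_nonneg _) (Finset.mem_univ i)

lemma nq_update (x : V d) (i : Fin d) (c : ℤ) :
    nq (x + c • sv i) = nq x + 2 * c * x i + c ^ 2 := by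
  unfold nq
  have h : ∀ j, (((x + c • sv i) j : ℤ) : ℝ) ^ 2
      = (x j : ℝ) ^ 2 + (if j = i then 2 * c * (x i : ℝ) + c ^ 2 else 0) := by
    intro j
    by_cases hj : j = i
    · subst hj; simp [sv]; ring
    · simp [sv, hj]
  simp_rw [h, Finset.sum_add_distrib]
  simp; ring

lemma nq_add (x : V d) (i : Fin d) : nq (x + sv i) = nq x + 1 + 2 * x i := by
  have := nq_update x i 1
  simp only [one_smul] at this; rw [this]; push_cast; ring

lemma nq_sub (x : V d) (i : Fin d) : nq (x - sv i) = nq x + 1 - 2 * x i := by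
  have := nq_update x i (-1)
  rw [show x + (-1 : ℤ) • sv i = x - sv i by simp [sub_eq_add_neg]] at this
  rw [this]; push_cast; ring

lemma mem_ball (x : V d) (r : ℕ) : x ∈ ball d r ↔ nq x ≤ (r : ℝ) ^ 2 := by
  have h : Real.sqrt (∑ i, ((x i : ℝ)) ^ 2) ≤ r ↔ nq x ≤ (r : ℝ) ^ 2 :=
    Real.sqrt_le_left (by positivity)
  unfold ball
  rw [Finset.mem_filter, h, and_iff_right_iff_imp]
  intro hx
  rw [Finset.mem_Icc]
  have : ∀ i, |(x i : ℝ)| ≤ r := fun i =>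
    abs_le_of_sq_le_sq ((sq_le_nq x i).trans hx) (by positivity)
  simp only [Int.ceil_natCast]
  constructor <;> intro i <;> have := abs_le.mp (this i)
  · have := this.1; simp only; exact_mod_cast this
  · have := this.2; simp only; exact_mod_cast this

lemma ball_mono {r s : ℕ} (h : r ≤ s) : ball d r ⊆ ball d s := by
  intro x hx
  rw [mem_ball] at *
  have : (r : ℝ) ≤ s := by exact_mod_cast h
  nlinarith [this, (Nat.cast_nonneg r : (0:ℝ) ≤ r)]

lemma abs_le_sqrt_nq (x : V d) (i : Fin d) : |(x i : ℝ)| ≤ Real.sqrt (nq x) :=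
  Real.abs_le_sqrt (sq_le_nq x i)

/-- neighbour relation -/
def Nb (x y : V d) : Prop := ∃ i, y = x + sv i ∨ y = x - sv i

lemma nb_add (x : V d) (i : Fin d) : Nb x (x + sv i) := ⟨i, Or.inl rfl⟩
lemma nb_sub (x : V d) (i : Fin d) : Nb x (x - sv i) := ⟨i, Or.inr rfl⟩

lemma nb_le {x y : V d} (h : Nb x y) {r : ℝ} (hr : 0 ≤ r) (hx : nq x ≤ r ^ 2) :
    nq y ≤ (r + 1) ^ 2 := by
  obtain ⟨i, rfl | rfl⟩ := h
  · rw [nq_add]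
    have := abs_le.mp (abs_le_of_sq_le_sq ((sq_le_nq x i).trans hx) hr)
    nlinarith [this.2]
  · rw [nq_sub]
    have := abs_le.mp (abs_le_of_sq_le_sq ((sq_le_nq x i).trans hx) hr)
    nlinarith [this.1]

lemma nb_ge {x y : V d} (h : Nb x y) {r : ℝ} (hr : 1 ≤ r) (hx : r ^ 2 ≤ nq x) :
    (r - 1) ^ 2 ≤ nq y := by
  set v := Real.sqrt (nq x) with hv
  have hv2 : v ^ 2 = nq x := Real.sq_sqrt (nq_nonneg x)
  have hvr : r ≤ v := Real.le_sqrt_of_sq_le hx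
  obtain ⟨i, rfl | rfl⟩ := h
  · rw [nq_add]
    have := abs_le.mp (abs_le_sqrt_nq x i)
    nlinarith [this.1]
  · rw [nq_sub]
    have := abs_le.mp (abs_le_sqrt_nq x i)
    nlinarith [this.2]

lemma nb_symm {x y : V d} (h : Nb x y) : Nb y x := by
  obtain ⟨i, rfl | rfl⟩ := h
  · exact ⟨i, Or.inr (by simp)⟩
  · exact ⟨i, Or.inl (by simp)⟩

lemma nb_mem {x y : V d} (h : Nb x y) {r : ℕ} (hx : x ∈ ball d r) : y ∈ ball d (r + 1 : ℕ) := by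
  rw [mem_ball] at *
  push_cast
  exact nb_le h (by positivity) hx

lemma L_mono {f g : V d → ℝ} {x : V d} {c : ℝ} (hx : f x = g x) (h : ∀ y, Nb x y → f y ≤ g y + c) :
    L f x ≤ L g x + 2 * d * c := by
  unfold L
  have : 2 * (d : ℝ) * c = ∑ _i : Fin d, 2 * c := by simp; ring
  rw [this, ← Finset.sum_add_distrib]
  apply Finset.sum_le_sum
  intro i _
  have := h _ (nb_add x i); have := h _ (nb_sub x i); rw [hx]; linarith

lemma L_sub_const (h : V d → ℝ) (c : ℝ) (x : V d) : L (fun y => h y - c) x = L h x := by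
  unfold L; apply Finset.sum_congr rfl; intros; ring

lemma L_comb (a b : ℝ) (f g : V d → ℝ) (x : V d) :
    L (fun y => a * f y + b * g y) x = a * L f x + b * L g x := by
  unfold L; rw [Finset.mul_sum, Finset.mul_sum, ← Finset.sum_add_distrib]
  apply Finset.sum_congr rfl; intros; ring

lemma L_nq (x : V d) : L nq x = 2 * d := by
  unfold L
  simp_rw [nq_add, nq_sub]
  rw [Finset.sum_congr rfl (g := fun _ => (2:ℝ)) (by intros; ring)]
  simp; ring

lemma pairing (u h : V d → ℝ) (A Λ : Finset (V d)) (hu : ∀ x, x ∉ A → u x = 0) (hA : A ⊆ Λ)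
    (hn : ∀ x ∈ A, ∀ y, Nb x y → y ∈ Λ) :
    ∑ x ∈ Λ, h x * L u x = ∑ x ∈ A, u x * L h x := by
  have shift : ∀ v : V d, (∀ x ∈ A, x - v ∈ Λ) →
      ∑ x ∈ Λ, h x * u (x + v) = ∑ x ∈ A, u x * h (x - v) := by
    intro v hv
    have h1 : ∑ x ∈ Λ, h x * u (x + v) = ∑ᶠ x, h x * u (x + v) := by
      symm; apply finsum_eq_sum_of_support_subset
      intro x hx
      have : u (x + v) ≠ 0 := right_ne_zero_of_mul hx
      have hm : x + v ∈ A := by by_contra h; exact this (hu _ h)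
      have := hv _ hm; simpa using this
    have h2 : ∑ x ∈ A, u x * h (x - v) = ∑ᶠ x, u x * h (x - v) := by
      symm; apply finsum_eq_sum_of_support_subset
      intro x hx
      have : u x ≠ 0 := left_ne_zero_of_mul hx
      by_contra h; exact this (hu _ h)
    rw [h1, h2, ← finsum_comp_equiv (Equiv.addRight v) (f := fun x => u x * h (x - v))]
    apply finsum_congr; intro x; simp [mul_comm]
  have zero : ∑ x ∈ Λ, h x * u x = ∑ x ∈ A, u x * h x := by
    have := shift 0 (fun x hx => by simpa using hA hx)
    simpa using this
  unfold L
  simp_rw [Finset.mul_sum]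
  rw [Finset.sum_comm, Finset.sum_comm (s := A)]
  apply Finset.sum_congr rfl
  intro i _
  have e1 := shift (sv i) (fun x hx => hn x hx _ (nb_sub x i))
  have e2 := shift (-sv i) (fun x hx => by simpa using hn x hx _ (nb_add x i))
  simp only [sub_neg_eq_add, ← sub_eq_add_neg] at e2
  simp_rw [mul_sub, mul_add, Finset.sum_sub_distrib, Finset.sum_add_distrib]
  rw [e1, e2]
  have z2 : ∑ x ∈ Λ, h x * (2 * u x) = ∑ x ∈ A, u x * (2 * h x) := by
    have : ∀ x, h x * (2 * u x) = 2 * (h x * u x) := fun x => by ring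
    simp_rw [this, ← Finset.mul_sum, zero, Finset.mul_sum]
    apply Finset.sum_congr rfl; intros; ring
  rw [z2]; ring

/-- expansions for the Laplacian of `gf q (nq x + a)` -/
lemma L_gf_eq (q a : ℝ) (x : V d) : L (fun y => gf q (nq y + a)) x =
    2 * d * (gf q (nq x + a + 1) - gf q (nq x + a + 1 - 1)) +
    ∑ i, (gf q (nq x + a + 1 + 2 * x i) + gf q (nq x + a + 1 - 2 * x i)
      - 2 * gf q (nq x + a + 1)) := by
  have : 2 * (d : ℝ) * (gf q (nq x + a + 1) - gf q (nq x + a + 1 - 1)) =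
    ∑ _i : Fin d, 2 * (gf q (nq x + a + 1) - gf q (nq x + a + 1 - 1)) := by simp; ring
  rw [this, ← Finset.sum_add_distrib]
  unfold L
  apply Finset.sum_congr rfl
  intro i _
  simp only [nq_add, nq_sub]
  rw [show nq x + 1 + 2 * (x i : ℝ) + a = nq x + a + 1 + 2 * x i by ring,
    show nq x + 1 - 2 * (x i : ℝ) + a = nq x + a + 1 - 2 * x i by ring]
  ring_nf

lemma rp_split (q : ℝ) {Q : ℝ} (hQ : 0 < Q) : Q ^ (-q) = Q * Q ^ (-(q + 1)) := by
  nth_rewrite 2 [← Real.rpow_one Q]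
  rw [← Real.rpow_add hQ]; ring_nf

lemma L_gf_ge (a : ℝ) (x : V d) (hQ : 2 ≤ nq x + a + 1)
    (hx : ∀ i, 4 * |(x i : ℝ)| ≤ nq x + a + 1) :
    -(2 * d * (a + 1 + (d / 2 : ℝ) * 2 ^ ((d / 2 : ℝ) + 1))) *
      (nq x + a + 1) ^ (-((d / 2 : ℝ) + 1)) ≤ L (fun y => gf (d / 2 : ℝ) (nq y + a)) x := by
  rw [L_gf_eq]
  set Q := nq x + a + 1 with hQd
  set q := (d / 2 : ℝ) with hq
  have hq0 : 0 ≤ q := by positivity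
  have h1 := gf_step_ge hq0 hQ
  have h2 : ∑ i, (q * Q ^ (-(q + 1)) * (2 * (x i : ℝ)) ^ 2) ≤
     ∑ i, (gf q (Q + 2 * x i) + gf q (Q - 2 * x i) - 2 * gf q Q) := by
    apply Finset.sum_le_sum
    intro i _
    apply gf_sym_ge hq0 _ (by linarith)
    rw [abs_mul]; norm_num; linarith [hx i]
  have h3 : ∑ i, (q * Q ^ (-(q + 1)) * (2 * (x i : ℝ)) ^ 2) = 2 * d * nq x * Q ^ (-(q + 1)) := by
    rw [nq, Finset.mul_sum, Finset.sum_mul]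
    apply Finset.sum_congr rfl; intro i _; rw [hq]; ring
  have h4 := rp_split q (show 0 < Q by linarith)
  have h5 : 2 * (d : ℝ) * (-(Q ^ (-q)) - q * 2 ^ (q + 1) * Q ^ (-(q + 1))) ≤
     2 * d * (gf q Q - gf q (Q - 1)) := mul_le_mul_of_nonneg_left h1 (by positivity)
  have h6 : -(2 * d * (a + 1 + q * 2 ^ (q + 1))) * Q ^ (-(q + 1)) =
    2 * (d : ℝ) * (-(Q * Q ^ (-(q + 1))) - q * 2 ^ (q + 1) * Q ^ (-(q + 1))) +
     2 * d * nq x * Q ^ (-(q + 1)) := by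
    rw [show nq x = Q - a - 1 by rw [hQd]; ring]; ring
  rw [h4] at h5; linarith

/-- constant in the superharmonicity estimate -/
noncomputable def KK (d : ℕ) : ℝ :=
  16 * ((d / 2 : ℝ) * ((d / 2 : ℝ) + 1) * ((d / 2 : ℝ) + 2) * 2 ^ ((d / 2 : ℝ) + 3))

lemma L_gf_le (a : ℝ) (x : V d) (hQ : 1 < nq x + a + 1) (ha : 0 ≤ a)
    (hx : ∀ i, 4 * |(x i : ℝ)| ≤ nq x + a + 1) :
    L (fun y => gf (d / 2 : ℝ) (nq y + a)) x ≤ (-(2 * d * (a + 1)) + KK d) *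
      (nq x + a + 1) ^ (-((d / 2 : ℝ) + 1)) := by
  rw [L_gf_eq]
  unfold KK
  set Q := nq x + a + 1 with hQd
  set q := (d / 2 : ℝ) with hq
  have hq0 : 0 ≤ q := by positivity
  have h1 := gf_step_le hq0 hQ
  set K := q * (q + 1) * (q + 2) * 2 ^ (q + 3) with hK
  have hK0 : 0 ≤ K := by positivity
  have h2 : ∑ i, (gf q (Q + 2 * x i) + gf q (Q - 2 * x i) - 2 * gf q Q) ≤
     ∑ i, (q * Q ^ (-(q + 1)) * (2 * (x i : ℝ)) ^ 2 + K * Q ^ (-(q + 3)) * (2 * (x i : ℝ)) ^ 4) := by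
    apply Finset.sum_le_sum
    intro i _
    apply gf_sym_le hq0 _ (by linarith)
    rw [abs_mul]; norm_num; linarith [hx i]
  have h3 : ∑ i, (q * Q ^ (-(q + 1)) * (2 * (x i : ℝ)) ^ 2) = 2 * d * nq x * Q ^ (-(q + 1)) := by
    rw [nq, Finset.mul_sum, Finset.sum_mul]
    apply Finset.sum_congr rfl; intro i _; rw [hq]; ring
  have h3' : ∑ i, (K * Q ^ (-(q + 3)) * (2 * (x i : ℝ)) ^ 4) ≤ 16 * K * Q ^ (-(q + 1)) := by
    have e : Q ^ (-(q + 1)) = Q ^ 2 * Q ^ (-(q + 3)) := by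
      rw [← Real.rpow_natCast, ← Real.rpow_add (by linarith)]; push_cast; ring_nf
    have : ∑ i, (x i : ℝ) ^ 4 ≤ Q ^ 2 := by
      calc ∑ i, (x i : ℝ) ^ 4 ≤ ∑ i, (x i : ℝ) ^ 2 * nq x := by
            apply Finset.sum_le_sum; intro i _
            have := sq_le_nq x i
            nlinarith [sq_nonneg (x i : ℝ)]
        _ = nq x ^ 2 := by rw [← Finset.sum_mul, ← nq]; ring
        _ ≤ Q ^ 2 := by
            have := nq_nonneg x
            apply pow_le_pow_left₀ this; linarith
    have e2 : ∑ i, (K * Q ^ (-(q + 3)) * (2 * (x i : ℝ)) ^ 4) =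
        16 * K * Q ^ (-(q + 3)) * ∑ i, (x i : ℝ) ^ 4 := by
      rw [Finset.mul_sum]; apply Finset.sum_congr rfl; intros; ring
    rw [e2, e]
    have hp : 0 ≤ 16 * K * Q ^ (-(q + 3)) := by
      have : 0 ≤ Q := by linarith
      positivity
    nlinarith [mul_le_mul_of_nonneg_left this hp]
  have h4 := rp_split q (show 0 < Q by linarith)
  have h5 : 2 * d * (gf q Q - gf q (Q - 1)) ≤ 2 * (d : ℝ) * (-(Q ^ (-q)))  :=
    mul_le_mul_of_nonneg_left h1 (by positivity)
  rw [Finset.sum_add_distrib, h3] at h2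
  have h6 : (-(2 * d * (a + 1)) + 16 * K) * Q ^ (-(q + 1)) =
    2 * (d : ℝ) * (-(Q * Q ^ (-(q + 1)))) + 2 * d * nq x * Q ^ (-(q + 1)) +
    16 * K * Q ^ (-(q + 1)) := by
    rw [show nq x = Q - a - 1 by rw [hQd]; ring]; ring
  rw [h4] at h5; linarith

end UIDLA


namespace UIDLA

variable {d : ℕ}

lemma KK_nonneg (d : ℕ) : 0 ≤ KK d := by unfold KK; positivity

/-- the shift parameter -/
noncomputable def aa (d : ℕ) : ℝ := KK d + 3

lemma aa_ge (d : ℕ) : 3 ≤ aa d := by unfold aa; linarith [KK_nonneg d]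

/-- decay profile -/
noncomputable def rho (x : V d) : ℝ := (nq x + aa d + 1) ^ (-((d / 2 : ℝ) + 1))

/-- regularised Green function -/
noncomputable def GG (x : V d) : ℝ := gf (d / 2 : ℝ) (nq x + aa d)

/-- constant for the lower bound of the Laplacian of the Green function -/
noncomputable def CG (d : ℕ) : ℝ := 2 * d * (aa d + 1 + (d / 2 : ℝ) * 2 ^ ((d / 2 : ℝ) + 1))

lemma rho_pos (x : V d) : 0 < rho x := by
  unfold rho
  have := nq_nonneg x; have := aa_ge d
  apply Real.rpow_pos_of_pos; linarith

lemma CG_nonneg (d : ℕ) : 0 ≤ CG d := by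
  unfold CG; have := aa_ge d; positivity

lemma four_abs (x : V d) {a : ℝ} (ha : 3 ≤ a) (i : Fin d) : 4 * |(x i : ℝ)| ≤ nq x + a + 1 := by
  have h1 := sq_le_nq x i
  rw [← sq_abs] at h1
  nlinarith [sq_nonneg (|(x i : ℝ)| - 2)]

lemma LG_ge (x : V d) : -(CG d) * rho x ≤ L GG x := by
  have h := L_gf_ge (aa d) x (by linarith [nq_nonneg x, aa_ge d]) (four_abs x (aa_ge d))
  exact h

lemma LG_le (hd : 1 ≤ d) (x : V d) : L GG x ≤ - rho x := by
  have h := L_gf_le (aa d) x (by linarith [nq_nonneg x, aa_ge d]) (by linarith [aa_ge d])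
    (four_abs x (aa_ge d))
  refine h.trans ?_
  have hd' : (1 : ℝ) ≤ d := by exact_mod_cast hd
  have h1 := aa_ge d
  have : -(2 * d * (aa d + 1)) + KK d ≤ -1 := by
    have : KK d = aa d - 3 := by unfold aa; ring
    rw [this]; nlinarith
  have h2 := rho_pos x
  unfold rho at *
  nlinarith

/-- multiplier -/
noncomputable def mm (d : ℕ) (r : ℝ) : ℝ := (r ^ 2 + aa d) ^ (d / 2 : ℝ)

/-- radial profile with a double zero at `r ^ 2` -/
noncomputable def Wf (d : ℕ) (r t : ℝ) : ℝ :=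
  t - r ^ 2 + mm d r * (gf (d / 2 : ℝ) (t + aa d) - gf (d / 2 : ℝ) (r ^ 2 + aa d))

lemma mm_pos (d : ℕ) (r : ℝ) : 0 < mm d r := by
  unfold mm; have := aa_ge d; positivity

lemma Wf_deriv (d : ℕ) (r : ℝ) {t : ℝ} (ht : 0 ≤ t) :
    HasDerivAt (Wf d r) (mm d r * ((r ^ 2 + aa d) ^ (-(d / 2 : ℝ)) - (t + aa d) ^ (-(d / 2 : ℝ)))) t := by
  have h1 := (gf_deriv (d / 2 : ℝ) (M := t + aa d) (by linarith [aa_ge d])).comp_add_const t (aa d)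
  have h2 := ((hasDerivAt_id t).sub_const (r ^ 2)).add
    ((h1.sub_const (gf (d / 2 : ℝ) (r ^ 2 + aa d))).const_mul (mm d r))
  refine HasDerivAt.congr_deriv h2 ?_
  have : mm d r * (r ^ 2 + aa d) ^ (-(d / 2 : ℝ)) = 1 := by
    unfold mm
    have := aa_ge d
    rw [← Real.rpow_add (by positivity)]; simp
  rw [mul_sub, this]; ring

lemma Wf_self (d : ℕ) (r : ℝ) : Wf d r (r ^ 2) = 0 := by simp [Wf]

lemma div_rp {p Q c : ℝ} (hQ : 0 < Q) (hc : 0 < c) : (Q / c) ^ (-p) = c ^ p * Q ^ (-p) := by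
  rw [Real.div_rpow hQ.le hc.le, Real.rpow_neg hc.le]
  field_simp

/-- bound for the profile near `r ^ 2` -/
noncomputable def C1 (d : ℕ) : ℝ := 6 * ((d / 2 : ℝ) * 4 ^ ((d / 2 : ℝ) + 1))

lemma C1_nonneg (d : ℕ) : 0 ≤ C1 d := by unfold C1; positivity

lemma Wf_nonneg (d : ℕ) (r : ℝ) {t : ℝ} (ht : 0 ≤ t) : 0 ≤ Wf d r t := by
  have ha := aa_ge d
  have hm := mm_pos d r
  have hq : 0 ≤ (d / 2 : ℝ) := by positivity
  have hr := sq_nonneg r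
  rcases lt_trichotomy t (r ^ 2) with h | h | h
  · obtain ⟨c, hc, e⟩ := mvt h (fun M hM => Wf_deriv d r (ht.trans hM.1))
    rw [Wf_self] at e
    have h1 := rp_anti hq (show 0 < c + aa d by linarith [hc.1]) (show c + aa d ≤ r ^ 2 + aa d by linarith [hc.2])
    have : mm d r * ((r ^ 2 + aa d) ^ (-(d / 2 : ℝ)) - (c + aa d) ^ (-(d / 2 : ℝ))) * (r ^ 2 - t) ≤ 0 :=
      mul_nonpos_of_nonpos_of_nonneg (mul_nonpos_of_nonneg_of_nonpos hm.le (by linarith)) (by linarith)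
    linarith
  · rw [h, Wf_self]
  · obtain ⟨c, hc, e⟩ := mvt h (fun M hM => Wf_deriv d r (hr.trans hM.1))
    rw [Wf_self] at e
    have h1 := rp_anti hq (show 0 < r ^ 2 + aa d by linarith [hc.1]) (show r ^ 2 + aa d ≤ c + aa d by linarith [hc.1])
    have : 0 ≤ mm d r * ((r ^ 2 + aa d) ^ (-(d / 2 : ℝ)) - (c + aa d) ^ (-(d / 2 : ℝ))) * (t - r ^ 2) :=
      mul_nonneg (mul_nonneg hm.le (by linarith)) (by linarith)
    linarith

lemma Wf_slope (d : ℕ) {r c : ℝ} (hr : 1 ≤ r) (h1 : (r - 1) ^ 2 ≤ c) (h2 : c ≤ (r + 1) ^ 2) :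
    |mm d r * ((r ^ 2 + aa d) ^ (-(d / 2 : ℝ)) - (c + aa d) ^ (-(d / 2 : ℝ)))| ≤
      (d / 2 : ℝ) * 4 ^ ((d / 2 : ℝ) + 1) * (r ^ 2 + aa d)⁻¹ * (2 * r + 1) := by
  have ha := aa_ge d
  have hm := mm_pos d r
  set q := (d / 2 : ℝ) with hqd
  have hq : 0 ≤ q := by positivity
  set R := r ^ 2 + aa d with hR
  have hR0 : 0 < R := by positivity
  have key : ∀ c', R / 4 ≤ c' → mm d r * (q * c' ^ (-(q + 1))) ≤ q * 4 ^ (q + 1) * R⁻¹ := by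
    intro c' hc'
    have e1 : c' ^ (-(q + 1)) ≤ 4 ^ (q + 1) * R ^ (-(q + 1)) := by
      rw [← div_rp hR0 (by norm_num)]; exact rp_anti (by linarith) (by linarith) hc'
    have e2 : mm d r * R ^ (-(q + 1)) = R⁻¹ := by
      unfold mm; rw [← hR, ← hqd, ← Real.rpow_add hR0, ← Real.rpow_neg_one]; ring_nf
    calc mm d r * (q * c' ^ (-(q + 1))) ≤ mm d r * (q * (4 ^ (q + 1) * R ^ (-(q + 1)))) := by gcongr
      _ = q * 4 ^ (q + 1) * (mm d r * R ^ (-(q + 1))) := by ring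
      _ = _ := by rw [e2]
  have hlow : R / 4 ≤ c + aa d := by
    have : 0 ≤ (3 * r - 4) ^ 2 := sq_nonneg _
    nlinarith
  have hd4 : R / 4 ≤ R := by linarith
  set B := q * 4 ^ (q + 1) * R⁻¹ with hB
  have hB0 : 0 ≤ B := by positivity
  rcases lt_trichotomy (c + aa d) R with h | h | h
  · obtain ⟨c', hc', e⟩ := mvt h (fun M hM => rp_deriv q (show 0 < M by linarith [hM.1]))
    have k := key c' (by linarith [hc'.1])
    have hk0 : 0 ≤ mm d r * (q * c' ^ (-(q + 1))) := by
      have : 0 ≤ c' := by linarith [hc'.1]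
      positivity
    rw [e, show mm d r * (-q * c' ^ (-(q + 1)) * (R - (c + aa d))) =
      -(mm d r * (q * c' ^ (-(q + 1))) * (R - (c + aa d))) by ring, abs_neg,
      abs_of_nonneg (mul_nonneg hk0 (by linarith))]
    apply mul_le_mul k (by nlinarith) (by linarith) hB0
  · rw [h]; simp; positivity
  · obtain ⟨c', hc', e⟩ := mvt h (fun M hM => rp_deriv q (show 0 < M by linarith [hM.1]))
    have k := key c' (by linarith [hc'.1])
    have hk0 : 0 ≤ mm d r * (q * c' ^ (-(q + 1))) := by
      have : 0 ≤ c' := by linarith [hc'.1]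
      positivity
    rw [show R ^ (-q) - (c + aa d) ^ (-q) = -((c + aa d) ^ (-q) - R ^ (-q)) by ring, e,
      show mm d r * -(-q * c' ^ (-(q + 1)) * ((c + aa d) - R)) =
      (mm d r * (q * c' ^ (-(q + 1))) * ((c + aa d) - R)) by ring,
      abs_of_nonneg (mul_nonneg hk0 (by linarith))]
    apply mul_le_mul k (by nlinarith) (by linarith) hB0

lemma Wf_le (d : ℕ) {r t : ℝ} (hr : 1 ≤ r) (h1 : (r - 1) ^ 2 ≤ t) (h2 : t ≤ (r + 1) ^ 2) :
    Wf d r t ≤ C1 d := by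
  have ha := aa_ge d
  have ht : 0 ≤ t := (sq_nonneg _).trans h1
  have hr2 := sq_nonneg r
  set B := (d / 2 : ℝ) * 4 ^ ((d / 2 : ℝ) + 1) with hB
  have hB0 : 0 ≤ B := by positivity
  have fin : B * (r ^ 2 + aa d)⁻¹ * (2 * r + 1) * (2 * r + 1) ≤ C1 d := by
    have : (r ^ 2 + aa d)⁻¹ * ((2 * r + 1) * (2 * r + 1)) ≤ 6 := by
      rw [inv_mul_le_iff₀ (by positivity)]
      nlinarith [sq_nonneg (r - 1)]
    unfold C1
    rw [← hB]
    calc _ = B * ((r ^ 2 + aa d)⁻¹ * ((2 * r + 1) * (2 * r + 1))) := by ring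
      _ ≤ B * 6 := by gcongr
      _ = _ := by ring
  rcases lt_trichotomy t (r ^ 2) with h | h | h
  · obtain ⟨c, hc, e⟩ := mvt h (fun M hM => Wf_deriv d r (ht.trans hM.1))
    rw [Wf_self] at e
    have s := (abs_le.mp (Wf_slope d hr (c := c) (by linarith [hc.1]) (by nlinarith [hc.2]))).1
    have : (-(B * (r ^ 2 + aa d)⁻¹ * (2 * r + 1))) * (r ^ 2 - t) ≤
       mm d r * ((r ^ 2 + aa d) ^ (-(d / 2 : ℝ)) - (c + aa d) ^ (-(d / 2 : ℝ))) * (r ^ 2 - t) :=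
      mul_le_mul_of_nonneg_right s (by linarith)
    have h3 : B * (r ^ 2 + aa d)⁻¹ * (2 * r + 1) * (r ^ 2 - t) ≤
      B * (r ^ 2 + aa d)⁻¹ * (2 * r + 1) * (2 * r + 1) := by
      apply mul_le_mul_of_nonneg_left (by nlinarith) (by positivity)
    linarith
  · rw [h, Wf_self]; exact C1_nonneg d
  · obtain ⟨c, hc, e⟩ := mvt h (fun M hM => Wf_deriv d r (hr2.trans hM.1))
    rw [Wf_self] at e
    have s := (abs_le.mp (Wf_slope d hr (c := c) (by nlinarith [hc.1]) (by nlinarith [hc.2]))).2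
    have : mm d r * ((r ^ 2 + aa d) ^ (-(d / 2 : ℝ)) - (c + aa d) ^ (-(d / 2 : ℝ))) * (t - r ^ 2) ≤
      ((B * (r ^ 2 + aa d)⁻¹ * (2 * r + 1))) * (t - r ^ 2) :=
      mul_le_mul_of_nonneg_right s (by linarith)
    have h3 : B * (r ^ 2 + aa d)⁻¹ * (2 * r + 1) * (t - r ^ 2) ≤
      B * (r ^ 2 + aa d)⁻¹ * (2 * r + 1) * (2 * r + 1) := by
      apply mul_le_mul_of_nonneg_left (by nlinarith) (by positivity)
    linarith

lemma L_W (r : ℝ) (x : V d) : L (fun y => Wf d r (nq y)) x = 2 * d + mm d r * L GG x := by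
  have h1 : (fun y : V d => Wf d r (nq y)) = fun y => (1 * nq y + mm d r * GG y) -
      (r ^ 2 + mm d r * gf (d / 2 : ℝ) (r ^ 2 + aa d)) := by
    funext y; unfold Wf GG; ring
  rw [h1, L_sub_const, L_comb, L_nq]; ring

open Classical in
/-- truncated profile -/
noncomputable def uW (r : ℕ) (x : V d) : ℝ := if x ∈ ball d r then Wf d r (nq x) else 0

lemma uW_le_inside {r : ℕ} {x : V d} (hx : x ∈ ball d r) :
    L (uW r) x ≤ 2 * d + mm d r * L GG x := by
  rw [← L_W]
  have := L_mono (f := uW r) (g := fun y => Wf d r (nq y)) (x := x) (c := 0) (by simp [uW, hx]) ?_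
  · linarith
  · intro y _
    unfold uW
    split_ifs
    · simp
    · simpa using Wf_nonneg d r (nq_nonneg y)

open Classical in
lemma uW_ge_inside {r : ℕ} (hr : 1 ≤ r) {x : V d} (hx : x ∈ ball d r) :
    2 * d + mm d r * L GG x ≤
      L (uW r) x + 2 * d * (if x ∈ ball d (r - 1 : ℕ) then 0 else C1 d) := by
  rw [← L_W]
  apply L_mono (by simp [uW, hx])
  intro y hy
  unfold uW
  have hr' : (1 : ℝ) ≤ r := by exact_mod_cast hr
  split_ifs with h1 h2 h2
  · simp
  · have := C1_nonneg d; linarith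
  · exfalso; apply h1
    have := nb_mem hy h2
    rwa [Nat.sub_add_cancel hr] at this
  · rw [zero_add]
    rw [mem_ball] at hx h1
    apply Wf_le d hr'
    · push Not at h1; nlinarith
    · exact nb_le hy (by linarith) hx

lemma uW_outside {r : ℕ} (hr : 1 ≤ r) {x : V d} (hx : x ∉ ball d r) :
    0 ≤ L (uW r) x ∧ L (uW r) x ≤ 2 * d * C1 d := by
  have z : L (fun _ : V d => (0:ℝ)) x = 0 := by simp [L]
  have hr' : (1 : ℝ) ≤ r := by exact_mod_cast hr
  constructor
  · have := L_mono (f := fun _ : V d => (0:ℝ)) (g := uW r) (x := x) (c := 0) (by simp [uW, hx]) ?_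
    · linarith
    · intro y _
      unfold uW
      split_ifs
      · simpa using Wf_nonneg d r (nq_nonneg y)
      · simp
  · have := L_mono (g := fun _ : V d => (0:ℝ)) (f := uW r) (x := x) (c := C1 d) (by simp [uW, hx]) ?_
    · linarith
    · intro y hy
      unfold uW
      split_ifs with h1
      · rw [zero_add]
        rw [mem_ball] at hx h1
        push Not at hx
        apply Wf_le d hr'
        · exact nb_ge hy hr' hx.le
        · nlinarith
      · simpa using C1_nonneg d

lemma pair_uW {r : ℕ} (h : V d → ℝ) (hh : ∀ x ∈ ball d r, L h x = 0) :
    ∑ x ∈ ball d (r + 1 : ℕ), h x * L (uW r) x = 0 := by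
  rw [pairing (uW r) h (ball d r) (ball d (r + 1 : ℕ)) (fun x hx => by simp [uW, hx])
    (ball_mono (by omega)) (fun x hx y hy => nb_mem hy hx)]
  apply Finset.sum_eq_zero
  intro x hx; rw [hh x hx, mul_zero]

open Classical in
lemma pair_split {r : ℕ} (f : V d → ℝ) : ∑ x ∈ ball d (r + 1 : ℕ), f x =
    ∑ x ∈ ball d r, f x + ∑ x ∈ ball d (r + 1 : ℕ) \ ball d r, f x := by
  exact (Finset.sum_sdiff (ball_mono (by omega))).symm.trans (add_comm _ _)

/-- sub-mean value estimate -/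
lemma submean (hd : 1 ≤ d) {r : ℕ} (hr : 1 ≤ r) (h : V d → ℝ) (h0 : ∀ x, 0 ≤ h x)
    (hh : ∀ x ∈ ball d r, L h x = 0) :
    mm d r * rho (0 : V d) * h 0 ≤ (2 * d + 2 * d * C1 d) * ∑ x ∈ ball d (r + 1 : ℕ), h x := by
  classical
  have hp := pair_uW h hh
  rw [pair_split] at hp
  have hC := C1_nonneg d
  have hm := mm_pos d r
  have i1 : ∑ x ∈ ball d r, h x * L (uW r) x ≤
      ∑ x ∈ ball d r, (2 * d * h x - (if x = 0 then mm d r * rho (0 : V d) * h 0 else 0)) := by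
    apply Finset.sum_le_sum
    intro x hx
    have h1 := uW_le_inside hx
    have h2 := LG_le hd x
    have h3 := rho_pos x
    have h4 := h0 x
    split_ifs with hx0
    · subst hx0
      have : h 0 * L (uW r) (0 : V d) ≤ h 0 * (2 * d + mm d r * (-rho (0 : V d))) := by
        apply mul_le_mul_of_nonneg_left _ h4
        have := mul_le_mul_of_nonneg_left h2 hm.le
        linarith
      linarith
    · have : h x * L (uW r) x ≤ h x * (2 * d + mm d r * 0) := by
        apply mul_le_mul_of_nonneg_left _ h4
        have := mul_le_mul_of_nonneg_left (h2.trans (by linarith : -rho x ≤ 0)) hm.le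
        linarith
      linarith
  have i2 : ∑ x ∈ ball d (r + 1 : ℕ) \ ball d r, h x * L (uW r) x ≤
      ∑ x ∈ ball d (r + 1 : ℕ) \ ball d r, 2 * d * C1 d * h x := by
    apply Finset.sum_le_sum
    intro x hx
    have h1 := (uW_outside hr (Finset.mem_sdiff.mp hx).2).2
    rw [mul_comm]
    exact mul_le_mul_of_nonneg_right h1 (h0 x)
  have hz : (0 : V d) ∈ ball d r := by rw [mem_ball, nq_zero]; positivity
  rw [Finset.sum_sub_distrib, Finset.sum_ite_eq' _ _ _, if_pos hz, ← Finset.mul_sum] at i1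
  rw [← Finset.mul_sum] at i2
  rw [pair_split]
  have p1 : 0 ≤ ∑ x ∈ ball d r, h x := Finset.sum_nonneg fun x _ => h0 x
  have p2 : 0 ≤ ∑ x ∈ ball d (r + 1 : ℕ) \ ball d r, h x := Finset.sum_nonneg fun x _ => h0 x
  have : 0 ≤ 2 * d * C1 d * ∑ x ∈ ball d r, h x := by positivity
  have : 0 ≤ 2 * d * ∑ x ∈ ball d (r + 1 : ℕ) \ ball d r, h x := by positivity
  linarith

/-- the one step recursion -/
lemma recursion (hd : 1 ≤ d) {r : ℕ} (hr : 1 ≤ r) (h : V d → ℝ) (h0 : ∀ x, 0 ≤ h x)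
    (hh : ∀ x ∈ ball d r, L h x = 0) (ε : ℝ) (hε : 0 ≤ ε)
    (hlip : ∀ x ∈ ball d r, - (ε * Real.sqrt (nq x + 1) * h 0) ≤ h x - h 0) :
    0 ≤ 2 * d * ∑ x ∈ ball d r, (h x - h 0)
      + mm d r * CG d * ε * h 0 * ∑ x ∈ ball d r, rho x * Real.sqrt (nq x + 1)
      + 2 * d * C1 d * h 0 * ((bn d r : ℝ) - bn d (r - 1))
      + 2 * d * C1 d * (∑ x ∈ ball d (r + 1 : ℕ), h x - ∑ x ∈ ball d r, h x) := by
  classical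
  have hp := pair_uW (r := r) (fun x => h x - h 0) (fun x hx => by rw [L_sub_const, hh x hx])
  rw [pair_split] at hp
  have hC := C1_nonneg d
  have hm := mm_pos d r
  have i1 : ∑ x ∈ ball d r, (h x - h 0) * L (uW r) x ≤
      ∑ x ∈ ball d r, (2 * d * (h x - h 0) +
        mm d r * CG d * ε * h 0 * (rho x * Real.sqrt (nq x + 1)) +
        2 * d * C1 d * h 0 * (if x ∈ ball d (r - 1 : ℕ) then 0 else 1)) := by
    apply Finset.sum_le_sum
    intro x hx
    have h1 := uW_le_inside hx
    have h1' := uW_ge_inside hr hx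
    have h2 := LG_le hd x
    have h2' := LG_ge x
    have h3 := rho_pos x
    have hl := hlip x hx
    have s0 := Real.sqrt_nonneg (nq x + 1)
    have hh0 := h0 0
    have hhx := h0 x
    set c : ℝ := (if x ∈ ball d (r - 1 : ℕ) then 0 else 1) with hc
    have hcc : (if x ∈ ball d (r - 1 : ℕ) then 0 else C1 d) = C1 d * c := by
      rw [hc]; split_ifs <;> simp
    rw [hcc] at h1'
    have hc0 : 0 ≤ c := by rw [hc]; split_ifs <;> norm_num
    set β := 2 * d + mm d r * L GG x - L (uW r) x with hβ
    have hβ0 : 0 ≤ β := by linarith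
    have hβ1 : β ≤ 2 * d * (C1 d * c) := by linarith
    have e : (h x - h 0) * L (uW r) x =
      2 * d * (h x - h 0) + mm d r * (L GG x * (h x - h 0)) - β * (h x - h 0) := by
      rw [hβ]; ring
    have f1 : L GG x * (h x - h 0) ≤ CG d * rho x * (ε * Real.sqrt (nq x + 1) * h 0) := by
      have a1 : 0 ≤ - L GG x := by linarith
      have a2 : (- L GG x) * (-(h x - h 0)) ≤ (- L GG x) * (ε * Real.sqrt (nq x + 1) * h 0) :=
        mul_le_mul_of_nonneg_left (by linarith) a1
      have a3 : (- L GG x) * (ε * Real.sqrt (nq x + 1) * h 0) ≤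
          CG d * rho x * (ε * Real.sqrt (nq x + 1) * h 0) :=
        mul_le_mul_of_nonneg_right (by linarith) (by positivity)
      linarith
    have f2 : - (β * (h x - h 0)) ≤ 2 * d * (C1 d * c) * h 0 := by
      have := mul_le_mul_of_nonneg_right hβ1 hh0
      have := mul_nonneg hβ0 hhx
      linarith
    have f3 := mul_le_mul_of_nonneg_left f1 hm.le
    rw [e]; linarith
  have i2 : ∑ x ∈ ball d (r + 1 : ℕ) \ ball d r, (h x - h 0) * L (uW r) x ≤
      ∑ x ∈ ball d (r + 1 : ℕ) \ ball d r, 2 * d * C1 d * h x := by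
    apply Finset.sum_le_sum
    intro x hx
    have h1 := uW_outside hr (Finset.mem_sdiff.mp hx).2
    have a := mul_le_mul_of_nonneg_right h1.2 (h0 x)
    have b := mul_nonneg h1.1 (h0 0)
    linarith
  have hcount : ∑ x ∈ ball d r, (if x ∈ ball d (r - 1 : ℕ) then (0:ℝ) else 1) =
      (bn d r : ℝ) - bn d (r - 1) := by
    have hs : ball d (r - 1 : ℕ) ⊆ ball d r := ball_mono (by omega)
    have : ∀ x, (if x ∈ ball d (r - 1 : ℕ) then (0:ℝ) else 1) =
      1 - (if x ∈ ball d (r - 1 : ℕ) then (1:ℝ) else 0) := by intro x; split_ifs <;> simp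
    simp_rw [this, Finset.sum_sub_distrib, Finset.sum_ite_mem,
      Finset.inter_eq_right.mpr hs]
    simp [bn]
  rw [Finset.sum_add_distrib, Finset.sum_add_distrib, ← Finset.mul_sum, ← Finset.mul_sum,
    ← Finset.mul_sum, hcount] at i1
  rw [← Finset.mul_sum] at i2
  have := pair_split (r := r) h
  rw [this]
  linarith

end UIDLA


namespace UIDLA

variable {d : ℕ}

/-- `ℓ¹` norm -/
def l1 (x : V d) : ℕ := ∑ i, (x i).natAbs

lemma l1_step {x : V d} (hx : x ≠ 0) :
    ∃ y, Nb y x ∧ nq y ≤ nq x - 1 ∧ l1 y + 1 = l1 x := by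
  obtain ⟨i, hi⟩ : ∃ i, x i ≠ 0 := by
    by_contra h; push Not at h; exact hx (funext h)
  have hl : ∀ y : V d, (∀ j, j ≠ i → y j = x j) → (y i).natAbs + 1 = (x i).natAbs →
      l1 y + 1 = l1 x := by
    intro y hj hi
    unfold l1
    rw [← Finset.add_sum_erase _ _ (Finset.mem_univ i),
      ← Finset.add_sum_erase (a := i) _ (fun i => (x i).natAbs) (Finset.mem_univ i), ← hi,
      Finset.sum_congr rfl (g := fun j => (x j).natAbs)]
    · ring
    · intro j hj'; rw [hj j (Finset.ne_of_mem_erase hj')]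
  rcases lt_or_gt_of_ne hi with h | h
  · refine ⟨x + sv i, ?_, ?_, ?_⟩
    · exact nb_symm (nb_add x i)
    · rw [nq_add]; have : (x i : ℝ) ≤ -1 := by exact_mod_cast (by omega : x i ≤ -1)
      linarith
    · apply hl
      · intro j hj; simp [sv, hj]
      · simp [sv]; omega
  · refine ⟨x - sv i, ?_, ?_, ?_⟩
    · exact nb_symm (nb_sub x i)
    · rw [nq_sub]; have : (1 : ℝ) ≤ x i := by exact_mod_cast h
      linarith
    · apply hl
      · intro j hj; simp [sv, hj]
      · simp [sv]; omega

lemma l1_eq_zero {x : V d} (h : l1 x = 0) : x = 0 := by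
  unfold l1 at h
  rw [Finset.sum_eq_zero_iff] at h
  funext i; simpa using h i (Finset.mem_univ i)

/-- a neighbour of a harmonic point -/
lemma harm_nb {h : V d → ℝ} (h0 : ∀ x, 0 ≤ h x) {x y : V d} (hx : L h x = 0) (hy : Nb x y) :
    h y ≤ 2 * d * h x := by
  unfold L at hx
  have e : ∑ i, (h (x + sv i) + h (x - sv i)) = 2 * d * h x := by
    have : ∑ i : Fin d, (h (x + sv i) + h (x - sv i)) - ∑ i : Fin d, (2 * h x) = 0 := by
      rw [← Finset.sum_sub_distrib]; exact hx
    simp at this; linarith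
  rw [← e]
  obtain ⟨i, hi⟩ := hy
  have : h (x + sv i) + h (x - sv i) ≤ ∑ i, (h (x + sv i) + h (x - sv i)) :=
    Finset.single_le_sum (f := fun i => h (x + sv i) + h (x - sv i))
      (fun i _ => add_nonneg (h0 _) (h0 _)) (Finset.mem_univ i)
  have := h0 (x + sv i); have := h0 (x - sv i)
  rcases hi with rfl | rfl <;> linarith

lemma chain {h : V d → ℝ} (h0 : ∀ x, 0 ≤ h x) {r : ℕ} (hh : ∀ x ∈ ball d r, L h x = 0) :
    ∀ (k : ℕ) (x : V d), l1 x = k → x ∈ ball d r → h x ≤ (2 * d) ^ k * h 0 := by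
  intro k
  induction k with
  | zero => intro x hx _; rw [l1_eq_zero hx]; simp
  | succ k ih =>
    intro x hx hb
    have hne : x ≠ 0 := by rintro rfl; simp [l1] at hx
    obtain ⟨y, hy1, hy2, hy3⟩ := l1_step hne
    have hyb : y ∈ ball d r := by rw [mem_ball] at *; linarith
    have h1 := ih y (by omega) hyb
    have h2 := harm_nb h0 (hh y hyb) hy1
    calc h x ≤ 2 * d * h y := h2
      _ ≤ 2 * d * ((2 * d) ^ k * h 0) := by gcongr
      _ = _ := by ring

lemma l1_le {x : V d} {N : ℕ} (hx : x ∈ ball d N) : l1 x ≤ d * N := by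
  have : ∀ i, (x i).natAbs ≤ N := by
    intro i
    rw [mem_ball] at hx
    have h := (sq_le_nq x i).trans hx
    have := abs_le_of_sq_le_sq h (by positivity)
    have := abs_le.mp (show |x i| ≤ (N : ℤ) by exact_mod_cast this)
    omega
  calc l1 x ≤ ∑ _i : Fin d, N := Finset.sum_le_sum fun i _ => this i
    _ = _ := by simp

lemma gf_anti {q x y : ℝ} (hx : 0 < x) (hxy : x ≤ y) : gf q y ≤ gf q x := by
  rcases hxy.eq_or_lt with rfl | h
  · rfl
  · obtain ⟨c, hc, e⟩ := mvt h (fun M hM => gf_deriv q (show 0 < M by linarith [hM.1]))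
    have : 0 < c := by linarith [hc.1]
    have : 0 ≤ c ^ (-q) := by positivity
    nlinarith

/-- shift -/
noncomputable def ab (d : ℕ) : ℝ := 2 + (d / 2 : ℝ) * 2 ^ ((d / 2 : ℝ) + 1)

lemma ab_ge (d : ℕ) : 2 ≤ ab d := by
  unfold ab; have : 0 ≤ (d / 2 : ℝ) * 2 ^ ((d / 2 : ℝ) + 1) := by positivity
  linarith

/-- truncated subharmonic Green function -/
noncomputable def psi (x : V d) : ℝ := gf (d / 2 : ℝ) (max (nq x - ab d) 1)

/-- threshold -/
noncomputable def N0 (d : ℕ) : ℝ := 2 * ab d + 14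

/-- constant -/
noncomputable def c2 (d : ℕ) : ℝ := gf (d / 2 : ℝ) 1 - gf (d / 2 : ℝ) (2 * N0 d + 2)

lemma c2_nonneg (d : ℕ) : 0 ≤ c2 d := by
  unfold c2 N0
  have := ab_ge d
  have := gf_anti (q := (d / 2 : ℝ)) (x := 1) (y := 2 * (2 * ab d + 14) + 2) (by norm_num)
    (by linarith)
  linarith

lemma nb_lower {x y : V d} (h : Nb x y) {B : ℝ} (hB : ∀ i, 4 * |(x i : ℝ)| ≤ B) :
    nq x + 1 - B / 2 ≤ nq y := by
  obtain ⟨i, rfl | rfl⟩ := h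
  · rw [nq_add]; have := hB i; have := neg_abs_le (x i : ℝ); linarith
  · rw [nq_sub]; have := hB i; have := le_abs_self (x i : ℝ); linarith

lemma psi_far {x : V d} (hx : N0 d ≤ nq x) : 0 ≤ L psi x := by
  have ha := ab_ge d
  unfold N0 at hx
  have h4 : ∀ i, 4 * |(x i : ℝ)| ≤ nq x + (-ab d) + 1 := by
    intro i
    have h1 := sq_le_nq x i
    rw [← sq_abs] at h1
    nlinarith [sq_nonneg (|(x i : ℝ)| - 4)]
  have h := L_gf_ge (-ab d) x (by linarith) h4
  have e : -(2 * (d : ℝ) * (-ab d + 1 + (d / 2 : ℝ) * 2 ^ ((d / 2 : ℝ) + 1))) = 2 * d := by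
    unfold ab; ring
  rw [e] at h
  have hp : 0 ≤ (2 * d : ℝ) * (nq x + (-ab d) + 1) ^ (-((d / 2 : ℝ) + 1)) := by
    have : 0 ≤ nq x + (-ab d) + 1 := by linarith
    positivity
  have := L_mono (f := fun y => gf (d / 2 : ℝ) (nq y + (-ab d))) (g := psi) (x := x) (c := 0) ?_ ?_
  · linarith
  · simp only [psi]; rw [max_eq_left (by linarith)]; rfl
  · intro y hy
    have := nb_lower hy h4
    simp only [psi]; rw [max_eq_left (by linarith), add_zero]; rfl

lemma psi_near {x : V d} (hx : nq x < N0 d) : -(2 * d * c2 d) ≤ L psi x := by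
  have ha := ab_ge d
  have z : L (fun _ : V d => psi x) x = 0 := by simp [L]; ring
  have := L_mono (f := fun _ => psi x) (g := psi) (x := x) (c := c2 d) rfl ?_
  · linarith
  · intro y hy
    have h1 : psi x ≤ gf (d / 2 : ℝ) 1 := gf_anti (by norm_num) (le_max_right _ _)
    have hs := Real.sq_sqrt (nq_nonneg x)
    have h2 : nq y ≤ (Real.sqrt (nq x) + 1) ^ 2 := nb_le hy (Real.sqrt_nonneg _) hs.ge
    have h3 : nq y ≤ 2 * N0 d + 2 := by nlinarith [sq_nonneg (Real.sqrt (nq x) - 1)]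
    have h4 : gf (d / 2 : ℝ) (2 * N0 d + 2) ≤ psi y := by
      apply gf_anti
      · exact lt_of_lt_of_le one_pos (le_max_right _ _)
      · apply max_le
        · linarith
        · have : N0 d = 2 * ab d + 14 := rfl
          linarith
    unfold c2; linarith

/-- multiplier -/
noncomputable def m3 (d : ℕ) (r : ℝ) : ℝ := (r + 1) ^ d

lemma m3_mul {r c : ℝ} (hr : 0 ≤ r) (hc : 0 < c) (hc' : c ≤ (r + 1) ^ 2) :
    1 ≤ m3 d r * c ^ (-(d / 2 : ℝ)) := by
  have e : m3 d r = ((r + 1) ^ 2) ^ (d / 2 : ℝ) := by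
    unfold m3
    rw [← Real.rpow_natCast (r + 1) 2, ← Real.rpow_mul (by linarith), ← Real.rpow_natCast]
    congr 1; push_cast; ring
  rw [e, Real.rpow_neg hc.le, ← div_eq_mul_inv, one_le_div (by positivity)]
  exact Real.rpow_le_rpow hc.le hc' (by positivity)

/-- barrier -/
noncomputable def W3 (r : ℝ) (x : V d) : ℝ :=
  (1 * nq x + m3 d r * psi x) - (r ^ 2 + m3 d r * gf (d / 2 : ℝ) (r ^ 2 - ab d))

lemma L_W3 (r : ℝ) (x : V d) : L (W3 r) x = 2 * d + m3 d r * L psi x := by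
  unfold W3
  rw [L_sub_const, L_comb, L_nq]; ring

lemma W3_nonpos {r : ℝ} (hr : 0 ≤ r) (hr2 : ab d + 1 ≤ r ^ 2) {y : V d} (h1 : r ^ 2 < nq y)
    (h2 : nq y ≤ (r + 1) ^ 2) : W3 r y ≤ 0 := by
  have ha := ab_ge d
  unfold W3 psi
  rw [max_eq_left (by linarith)]
  obtain ⟨c, hc, e⟩ := mvt (show r ^ 2 - ab d < nq y - ab d by linarith)
    (fun M hM => gf_deriv (d / 2 : ℝ) (show 0 < M by linarith [hM.1]))
  have := m3_mul (d := d) (c := c) hr (by linarith [hc.1]) (by linarith [hc.2])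
  have e2 : m3 d r * gf (d / 2 : ℝ) (nq y - ab d) - m3 d r * gf (d / 2 : ℝ) (r ^ 2 - ab d) =
    -(m3 d r * c ^ (-(d / 2 : ℝ))) * (nq y - r ^ 2) := by
    rw [← mul_sub, e]; ring
  nlinarith

lemma W3_nonneg {r : ℝ} (hr : 0 ≤ r) (hr2 : ab d + 1 ≤ (r - 1) ^ 2) {y : V d}
    (h1 : (r - 1) ^ 2 ≤ nq y) (h2 : nq y ≤ r ^ 2) : 0 ≤ W3 r y := by
  have ha := ab_ge d
  unfold W3 psi
  rw [max_eq_left (by linarith)]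
  rcases h2.eq_or_lt with h2 | h2
  · rw [h2]; simp
  obtain ⟨c, hc, e⟩ := mvt (show nq y - ab d < r ^ 2 - ab d by linarith)
    (fun M hM => gf_deriv (d / 2 : ℝ) (show 0 < M by linarith [hM.1]))
  have := m3_mul (d := d) (c := c) hr (by linarith [hc.1]) (by nlinarith [hc.2])
  have e2 : m3 d r * gf (d / 2 : ℝ) (r ^ 2 - ab d) - m3 d r * gf (d / 2 : ℝ) (nq y - ab d) =
    -(m3 d r * c ^ (-(d / 2 : ℝ))) * (r ^ 2 - nq y) := by
    rw [← mul_sub, e]; ring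
  nlinarith

open Classical in
/-- truncated barrier -/
noncomputable def u3 (r : ℕ) (x : V d) : ℝ := if x ∈ ball d r then W3 r x else 0

lemma u3_inside {r : ℕ} (hr2 : ab d + 1 ≤ (r : ℝ) ^ 2) {x : V d} (hx : x ∈ ball d r) :
    2 * d + m3 d r * L psi x ≤ L (u3 r) x := by
  rw [← L_W3]
  have := L_mono (f := W3 r) (g := u3 r) (x := x) (c := 0) (by simp [u3, hx]) ?_
  · linarith
  · intro y hy
    unfold u3
    split_ifs with h
    · simp
    · rw [mem_ball] at h hx
      push Not at h
      rw [zero_add]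
      exact W3_nonpos (by positivity) hr2 h (nb_le hy (by positivity) hx)

lemma u3_outside {r : ℕ} (hr : 1 ≤ r) (hr2 : ab d + 1 ≤ ((r : ℝ) - 1) ^ 2) {x : V d}
    (hx : x ∉ ball d r) : 0 ≤ L (u3 r) x := by
  have z : L (fun _ : V d => (0:ℝ)) x = 0 := by simp [L]
  have hr' : (1 : ℝ) ≤ r := by exact_mod_cast hr
  have := L_mono (f := fun _ : V d => (0:ℝ)) (g := u3 r) (x := x) (c := 0) (by simp [u3, hx]) ?_
  · linarith
  · intro y hy
    unfold u3
    split_ifs with h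
    · rw [mem_ball] at h hx
      push Not at hx
      rw [add_zero]
      exact W3_nonneg (by positivity) hr2 (nb_ge hy hr' hx.le) h
    · simp

lemma pair_u3 {r : ℕ} (h : V d → ℝ) (hh : ∀ x ∈ ball d r, L h x = 0) :
    ∑ x ∈ ball d (r + 1 : ℕ), h x * L (u3 r) x = 0 := by
  rw [pairing (u3 r) h (ball d r) (ball d (r + 1 : ℕ)) (fun x hx => by simp [u3, hx])
    (ball_mono (by omega)) (fun x hx y hy => nb_mem hy hx)]
  apply Finset.sum_eq_zero
  intro x hx; rw [hh x hx, mul_zero]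

/-- upper mean value estimate -/
lemma supermean (hd : 1 ≤ d) : ∃ C : ℝ, 0 < C ∧ ∃ r1 : ℕ, ∀ r : ℕ, r1 ≤ r → ∀ h : V d → ℝ,
    (∀ x, 0 ≤ h x) → (∀ x ∈ ball d r, L h x = 0) →
    ∑ x ∈ ball d r, h x ≤ C * ((r : ℝ) + 1) ^ d * h 0 := by
  classical
  have ha := ab_ge d
  obtain ⟨N1, hN1⟩ := exists_nat_ge (N0 d)
  have hN0 : 1 ≤ N0 d := by unfold N0; linarith
  have hd' : (1 : ℝ) ≤ d := by exact_mod_cast hd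
  obtain ⟨r1, hr1⟩ := exists_nat_ge (ab d + 2)
  refine ⟨c2 d * (bn d N1) * (2 * d) ^ (d * N1) + 1, by have := c2_nonneg d; positivity, r1, ?_⟩
  intro r hr h h0 hh
  have hrr : ab d + 2 ≤ (r : ℝ) := hr1.trans (by exact_mod_cast hr)
  have hp := pair_u3 h hh
  rw [pair_split] at hp
  have i2 : 0 ≤ ∑ x ∈ ball d (r + 1 : ℕ) \ ball d r, h x * L (u3 r) x := by
    apply Finset.sum_nonneg
    intro x hx
    exact mul_nonneg (h0 x) (u3_outside (by have : (1:ℝ) ≤ r := by linarith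
                                            exact_mod_cast this) (by nlinarith) (Finset.mem_sdiff.mp hx).2)
  have hm : 0 < m3 d r := by unfold m3; positivity
  have hc2 := c2_nonneg d
  have i1 : ∑ x ∈ ball d r, (2 * d * h x -
      (if x ∈ ball d N1 then m3 d r * (2 * d * c2 d) * ((2 * d) ^ (d * N1) * h 0) else 0)) ≤
      ∑ x ∈ ball d r, h x * L (u3 r) x := by
    apply Finset.sum_le_sum
    intro x hx
    have h1 := u3_inside (by nlinarith) hx
    have hhx := h0 x
    have h2 := mul_le_mul_of_nonneg_left h1 hhx
    by_cases hf : N0 d ≤ nq x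
    · have h3 := psi_far hf
      have : 0 ≤ h x * (m3 d r * L psi x) := by positivity
      have : 0 ≤ (if x ∈ ball d N1 then m3 d r * (2 * d * c2 d) * ((2 * d) ^ (d * N1) * h 0) else 0) := by
        have := h0 0
        split_ifs <;> positivity
      linarith
    · push Not at hf
      have h3 := psi_near hf
      have hxN : x ∈ ball d N1 := by
        rw [mem_ball]
        nlinarith
      rw [if_pos hxN]
      have h4 := chain h0 hh _ x rfl hx
      have h5 : h x ≤ (2 * d) ^ (d * N1) * h 0 := by
        refine h4.trans ?_
        have := h0 0
        gcongr
        · linarith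
        · exact l1_le hxN
      have h6 : m3 d r * (-(2 * d * c2 d)) ≤ m3 d r * L psi x := by gcongr
      have h7 := mul_le_mul_of_nonneg_left h6 hhx
      have h8 : m3 d r * (2 * d * c2 d) * h x ≤
          m3 d r * (2 * d * c2 d) * ((2 * d) ^ (d * N1) * h 0) := by gcongr
      linarith
  rw [Finset.sum_sub_distrib, ← Finset.mul_sum, Finset.sum_ite_mem] at i1
  have i3 : ∑ x ∈ ball d r ∩ ball d N1, m3 d r * (2 * d * c2 d) * ((2 * d) ^ (d * N1) * h 0) ≤
      (bn d N1) * (m3 d r * (2 * d * c2 d) * ((2 * d) ^ (d * N1) * h 0)) := by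
    rw [Finset.sum_const, nsmul_eq_mul]
    have := h0 0
    gcongr
    exact Finset.card_le_card Finset.inter_subset_right
  have hh0 := h0 0
  have key : 2 * (d : ℝ) * ∑ x ∈ ball d r, h x ≤
      2 * d * ((c2 d * (bn d N1) * (2 * d) ^ (d * N1)) * m3 d r * h 0) := by
    linarith
  have key2 := le_of_mul_le_mul_left key (by positivity)
  refine key2.trans ?_
  unfold m3
  gcongr
  linarith

lemma nq_tri {x y : V d} {a b : ℝ} (ha : 0 ≤ a) (hb : 0 ≤ b) (hx : nq x ≤ a ^ 2) (hy : nq y ≤ b ^ 2) :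
    nq (x + y) ≤ (a + b) ^ 2 := by
  have cs := Finset.sum_mul_sq_le_sq_mul_sq Finset.univ (fun i => (x i : ℝ)) (fun i => (y i : ℝ))
  have e : nq (x + y) = nq x + nq y + 2 * ∑ i, (x i : ℝ) * y i := by
    unfold nq
    rw [Finset.mul_sum, ← Finset.sum_add_distrib, ← Finset.sum_add_distrib]
    apply Finset.sum_congr rfl; intros; simp; ring
  change (∑ i, (x i : ℝ) * y i) ^ 2 ≤ nq x * nq y at cs
  have : (∑ i, (x i : ℝ) * y i) ^ 2 ≤ (a * b) ^ 2 := by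
    refine cs.trans ?_
    rw [mul_pow]; gcongr; exact nq_nonneg y
  have := (le_abs_self _).trans (abs_le_of_sq_le_sq this (by positivity))
  rw [e]; nlinarith

lemma L_trans (h : V d → ℝ) (x y : V d) : L (fun z => h (x + z)) y = L h (x + y) := by
  unfold L
  apply Finset.sum_congr rfl; intro i _
  simp only [add_assoc, add_sub_assoc]

lemma tri_mem {x y : V d} {a b n : ℕ} (hx : x ∈ ball d a) (hy : y ∈ ball d b) (h : a + b ≤ n) :
    x + y ∈ ball d n := by
  rw [mem_ball] at *
  refine (nq_tri (by positivity) (by positivity) hx hy).trans ?_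
  have : (a + b : ℝ) ≤ n := by exact_mod_cast h
  gcongr

/-- Harnack inequality -/
lemma harnack (hd : 1 ≤ d) : ∃ C : ℝ, 0 < C ∧ ∃ n1 : ℕ, ∀ n k : ℕ, n1 ≤ n → 2 * k + 1 ≤ n →
    n ≤ 2 * k + 2 → ∀ h : V d → ℝ,
    (∀ x, 0 ≤ h x) → (∀ x ∈ ball d n, L h x = 0) → ∀ x ∈ ball d k, h x ≤ C * h 0 := by
  obtain ⟨C, hC, r1, hs⟩ := supermean hd
  have hrho := rho_pos (0 : V d)
  have hC1 := C1_nonneg d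
  have hd' : (1 : ℝ) ≤ d := by exact_mod_cast hd
  refine ⟨(2 * d + 2 * d * C1 d) * C * 5 ^ d / rho (0 : V d), by positivity, max r1 5, ?_⟩
  intro n k hn h1 h2 h h0 hh x hx
  have hk : 1 ≤ k := by have := le_max_right r1 5; omega
  have hr1 : r1 ≤ n := (le_max_left _ _).trans hn
  have s1 := submean hd hk (fun z => h (x + z)) (fun z => h0 _) (fun z hz => by
    rw [L_trans]; exact hh _ (tri_mem hx hz (by omega)))
  rw [add_zero] at s1
  have s2 := hs n hr1 h h0 hh
  have s3 : ∑ z ∈ ball d (k + 1 : ℕ), h (x + z) ≤ ∑ z ∈ ball d n, h z := by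
    classical
    rw [← Finset.sum_image (f := h) (g := fun z => x + z) (by intro a _ b _ hab; simpa using hab)]
    apply Finset.sum_le_sum_of_subset_of_nonneg
    · intro w hw
      obtain ⟨z, hz, rfl⟩ := Finset.mem_image.mp hw
      exact tri_mem hx hz (by omega)
    · intros; exact h0 _
  have hm : (k : ℝ) ^ d ≤ mm d k := by
    unfold mm
    have := aa_ge d
    calc (k : ℝ) ^ d = ((k : ℝ) ^ 2) ^ (d / 2 : ℝ) := by
          rw [← Real.rpow_natCast (k : ℝ) 2, ← Real.rpow_mul (by positivity), ← Real.rpow_natCast]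
          congr 1; push_cast; ring
      _ ≤ _ := by apply Real.rpow_le_rpow (by positivity) (by linarith) (by positivity)
  have hn5 : ((n : ℝ) + 1) ^ d ≤ 5 ^ d * (k : ℝ) ^ d := by
    rw [← mul_pow]
    gcongr
    have : n + 1 ≤ 5 * k := by omega
    exact_mod_cast this
  have hhx := h0 x
  have hh0 := h0 0
  have hkd : 0 < (k : ℝ) ^ d := by positivity
  have t : (k : ℝ) ^ d * (rho (0 : V d) * h x) ≤
      (k : ℝ) ^ d * ((2 * d + 2 * d * C1 d) * C * 5 ^ d * h 0) := by
    calc (k : ℝ) ^ d * (rho (0 : V d) * h x) ≤ mm d k * (rho (0 : V d) * h x) := by gcongr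
      _ = mm d k * rho (0 : V d) * h x := by ring
      _ ≤ (2 * d + 2 * d * C1 d) * ∑ z ∈ ball d (k + 1 : ℕ), h (x + z) := s1
      _ ≤ (2 * d + 2 * d * C1 d) * (C * ((n : ℝ) + 1) ^ d * h 0) := by
          gcongr; exact s3.trans s2
      _ ≤ (2 * d + 2 * d * C1 d) * (C * (5 ^ d * (k : ℝ) ^ d) * h 0) := by gcongr
      _ = _ := by ring
  have t2 := le_of_mul_le_mul_left t hkd
  rw [div_mul_eq_mul_div, le_div_iff₀ hrho]
  linarith

end UIDLA


namespace UIDLA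

variable {d : ℕ}

/-- maximum principle -/
lemma max_principle (i : Fin d) (f : V d → ℝ) (A : Finset (V d))
    (hL : ∀ x ∈ A, 0 < f x → 0 ≤ L f x)
    (hb : ∀ x ∈ A, ∀ y, Nb x y → y ∉ A → f y ≤ 0) : ∀ x ∈ A, f x ≤ 0 := by
  classical
  by_contra hcon
  push Not at hcon
  obtain ⟨x0, hx0, hpos⟩ := hcon
  obtain ⟨x1, hx1, hmax⟩ := A.exists_max_image f ⟨x0, hx0⟩
  obtain ⟨x, hx, hmx⟩ := (A.filter (fun z => f z = f x1)).exists_max_image (fun z => z i)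
    ⟨x1, by simp [hx1]⟩
  rw [Finset.mem_filter] at hx
  obtain ⟨hxA, hxf⟩ := hx
  have hp : 0 < f x := by rw [hxf]; exact hpos.trans_le (hmax _ hx0)
  have hle : ∀ y, Nb x y → f y ≤ f x := by
    intro y hy
    by_cases hyA : y ∈ A
    · rw [hxf]; exact hmax y hyA
    · exact (hb x hxA y hy hyA).trans hp.le
  have h0 := hL x hxA hp
  have heq : f (x + sv i) = f x := by
    apply le_antisymm (hle _ (nb_add x i))
    by_contra hlt
    push Not at hlt
    have : L f x < ∑ _i : Fin d, (0:ℝ) := by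
      unfold L
      apply Finset.sum_lt_sum
      · intro j _
        have := hle _ (nb_add x j); have := hle _ (nb_sub x j); linarith
      · refine ⟨i, Finset.mem_univ i, ?_⟩
        have := hle _ (nb_sub x i); linarith
    simp at this
    linarith
  have hmem : x + sv i ∈ A := by
    by_contra hn
    have := hb x hxA _ (nb_add x i) hn
    linarith
  have := hmx (x + sv i) (by rw [Finset.mem_filter]; exact ⟨hmem, by rw [heq, hxf]⟩)
  simp [sv] at this

/-- reflection in the hyperplane `y i = 1/2` -/
def refl1 (i : Fin d) (y : V d) : V d := Function.update y i (1 - y i)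

lemma refl1_self (i : Fin d) (y : V d) : refl1 i y i = 1 - y i := by simp [refl1]

lemma nq_refl1 (i : Fin d) (y : V d) : nq (refl1 i y) = nq y + 1 - 2 * y i := by
  have e : refl1 i y = y + (1 - 2 * y i) • sv i := by
    funext j; by_cases h : j = i
    · subst h; simp [refl1, sv]; ring
    · simp [refl1, h, sv]
  rw [e, nq_update]; push_cast; ring

lemma refl1_invol (i : Fin d) (y : V d) : refl1 i (refl1 i y) = y := by
  funext j; by_cases h : j = i
  · subst h; simp [refl1]
  · simp [refl1, h]

lemma refl1_add_self (i : Fin d) (y : V d) : refl1 i (y + sv i) = refl1 i y - sv i := by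
  funext j; by_cases h : j = i
  · subst h; simp [refl1, sv]; try ring
  · simp [refl1, h, sv]

lemma refl1_sub_self (i : Fin d) (y : V d) : refl1 i (y - sv i) = refl1 i y + sv i := by
  funext j; by_cases h : j = i
  · subst h; simp [refl1, sv]; try ring
  · simp [refl1, h, sv]

lemma refl1_add_ne {i k : Fin d} (hk : k ≠ i) (y : V d) :
    refl1 i (y + sv k) = refl1 i y + sv k := by
  funext j; by_cases h : j = i
  · subst h; simp [refl1, sv, hk.symm]
  · simp [refl1, h, sv]

lemma refl1_sub_ne {i k : Fin d} (hk : k ≠ i) (y : V d) :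
    refl1 i (y - sv k) = refl1 i y - sv k := by
  funext j; by_cases h : j = i
  · subst h; simp [refl1, sv, hk.symm]
  · simp [refl1, h, sv]

lemma L_refl1 (i : Fin d) (h : V d → ℝ) (x : V d) :
    L (fun y => h (refl1 i y)) x = L h (refl1 i x) := by
  unfold L
  apply Finset.sum_congr rfl
  intro k _
  beta_reduce
  by_cases hk : k = i
  · subst hk; rw [refl1_add_self, refl1_sub_self]; ring
  · rw [refl1_add_ne hk, refl1_sub_ne hk]

/-- harmonic barrier for the gradient estimate -/
noncomputable def gbar (i : Fin d) (M R : ℝ) (y : V d) : ℝ :=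
  M * (nq y - d * (y i : ℝ) ^ 2 + d * (R + 1) * y i) / R ^ 2

lemma L_coord_lin (i : Fin d) (x : V d) : L (fun y => (y i : ℝ)) x = 0 := by
  unfold L
  apply Finset.sum_eq_zero
  intro k _
  simp; ring

lemma L_coord_sq (i : Fin d) (x : V d) : L (fun y => (y i : ℝ) ^ 2) x = 2 := by
  unfold L
  rw [Finset.sum_eq_single i]
  · simp [sv]; ring
  · intro k _ hk; simp [sv, hk.symm]; ring
  · simp

lemma L_gbar (i : Fin d) (M R : ℝ) (x : V d) : L (gbar i M R) x = 0 := by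
  have e : gbar i M R = fun y => (M / R ^ 2) * ((fun y => 1 * nq y + (-d : ℝ) * (fun y : V d => (y i : ℝ) ^ 2) y) y)
      + (M / R ^ 2 * (d * (R + 1))) * (fun y : V d => (y i : ℝ)) y := by
    funext y; unfold gbar; ring
  rw [e, L_comb, L_comb, L_nq, L_coord_sq, L_coord_lin]; ring

lemma L_sub (f g : V d → ℝ) (x : V d) : L (fun y => f y - g y) x = L f x - L g x := by
  unfold L; rw [← Finset.sum_sub_distrib]
  apply Finset.sum_congr rfl; intros; ring

open Classical in
lemma grad_one (i : Fin d) {R : ℕ} (hR : 1 ≤ R) (h : V d → ℝ) (M : ℝ)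
    (h0 : ∀ x ∈ ball d (R + 1 : ℕ), 0 ≤ h x) (hM : ∀ x ∈ ball d (R + 1 : ℕ), h x ≤ M)
    (hh : ∀ x ∈ ball d R, L h x = 0) : h (sv i) - h 0 ≤ M * (d + 1) / R := by
  have hR' : (1 : ℝ) ≤ R := by exact_mod_cast hR
  have hMn : 0 ≤ M := by
    have hz : (0 : V d) ∈ ball d (R + 1 : ℕ) := by rw [mem_ball, nq_zero]; positivity
    exact (h0 0 hz).trans (hM 0 hz)
  have hsub : ball d R ⊆ ball d (R + 1 : ℕ) := ball_mono (by omega)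
  set g : V d → ℝ := fun y => h y - h (refl1 i y) with hg
  set gt : V d → ℝ := fun y => if 1 ≤ y i then g y else 0 with hgt
  set A : Finset (V d) := (ball d R).filter (fun y => 1 ≤ y i) with hA
  have habs : ∀ (s : ℕ) (y : V d), y ∈ ball d s → (y i : ℝ) ≤ s := by
    intro s y hy
    rw [mem_ball] at hy
    exact (le_abs_self _).trans (abs_le_of_sq_le_sq ((sq_le_nq y i).trans hy) (by positivity))
  have hgb : ∀ y ∈ ball d (R + 1 : ℕ), 0 ≤ y i → M * nq y / (R : ℝ) ^ 2 ≤ gbar i M R y := by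
    intro y hy hyi
    have h1 := habs _ _ hy
    push_cast at h1
    have h2 : (0 : ℝ) ≤ y i := by exact_mod_cast hyi
    unfold gbar
    gcongr
    have : 0 ≤ (d : ℝ) * (y i * (R + 1 - y i)) :=
      mul_nonneg (by positivity) (mul_nonneg h2 (by linarith))
    linarith
  have hgb0 : ∀ y ∈ ball d (R + 1 : ℕ), 0 ≤ y i → 0 ≤ gbar i M R y := by
    intro y hy hyi
    refine le_trans ?_ (hgb y hy hyi)
    have := nq_nonneg y
    positivity
  have hrefl : ∀ (s : ℕ) (y : V d), y ∈ ball d s → 1 ≤ y i → refl1 i y ∈ ball d s := by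
    intro s y hy hyi
    rw [mem_ball] at *
    rw [nq_refl1]
    have : (1 : ℝ) ≤ y i := by exact_mod_cast hyi
    linarith
  have key := max_principle i (fun y => gt y - gbar i M R y) A ?_ ?_ (sv i) ?_
  · have e1 : gt (sv i) = h (sv i) - h 0 := by
      have : refl1 i (sv i) = 0 := by
        funext j; by_cases hj : j = i
        · subst hj; simp [refl1, sv]
        · simp [refl1, hj, sv]
      simp only [hgt, hg, this]
      rw [if_pos (by simp [sv])]
    rw [e1] at key
    have e2 : gbar i M R (sv i) ≤ M * (d + 1) / R := by
      have n1 : nq (sv i : V d) = 1 := by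
        have := nq_add (0 : V d) i; rw [zero_add, nq_zero] at this; simpa using this
      unfold gbar
      rw [n1]
      have : ((sv i : V d) i : ℝ) = 1 := by simp [sv]
      rw [this, div_le_div_iff₀ (by positivity) (by positivity)]
      have : (1 - d * (1:ℝ) ^ 2 + d * (R + 1) * 1) * R ≤ (d + 1) * (R : ℝ) ^ 2 := by
        nlinarith
      nlinarith
    linarith
  · intro x hx hpos
    rw [hA, Finset.mem_filter] at hx
    obtain ⟨hxb, hxi⟩ := hx
    have hb0 := hgb0 x (hsub hxb) (by omega)
    have hgx : gt x = g x := by simp only [hgt]; rw [if_pos hxi]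
    rw [hgx] at hpos
    have hLg : L g x = 0 := by
      rw [hg, L_sub, L_refl1, hh x hxb, hh _ (hrefl _ x hxb hxi)]; ring
    rw [L_sub, L_gbar, sub_zero, ← hLg]
    have := L_mono (f := g) (g := gt) (x := x) (c := 0) hgx.symm ?_
    · linarith
    · intro y hy
      rw [add_zero]
      simp only [hgt]
      split_ifs with hyi
      · exact le_rfl
      · have : y = x - sv i ∧ x i = 1 := by
          obtain ⟨k, rfl | rfl⟩ := hy
          · exfalso; apply hyi
            by_cases hk : i = k
            · subst hk; simp [sv]; omega
            · simp [sv, hk]; omega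
          · by_cases hk : i = k
            · subst hk; simp [sv] at hyi; exact ⟨rfl, by omega⟩
            · exfalso; apply hyi; simp [sv, hk]; omega
        obtain ⟨rfl, hx1⟩ := this
        have er : refl1 i x = x - sv i := by
          funext j; by_cases hj : j = i
          · subst hj; simp [refl1, sv, hx1]
          · simp [refl1, hj, sv]
        have er2 : refl1 i (x - sv i) = x := by rw [← er, refl1_invol]
        simp only [hg] at hpos ⊢
        rw [er2]
        rw [er] at hpos
        linarith
  · intro x hx y hy hyA
    rw [hA, Finset.mem_filter] at hx
    obtain ⟨hxb, hxi⟩ := hx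
    have hyb := nb_mem hy hxb
    have hyi0 : 0 ≤ y i := by
      obtain ⟨k, rfl | rfl⟩ := hy
      · by_cases hk : i = k
        · subst hk; simp [sv]; omega
        · simp [sv, hk]; omega
      · by_cases hk : i = k
        · subst hk; simp [sv]; omega
        · simp [sv, hk]; omega
    simp only [hgt]
    split_ifs with hyi
    · have hyR : (R : ℝ) ^ 2 < nq y := by
        by_contra hcon
        push Not at hcon
        exact hyA (by rw [hA, Finset.mem_filter, mem_ball]; exact ⟨hcon, hyi⟩)
      have h1 := hgb y hyb hyi0
      have h2 : M ≤ M * nq y / (R : ℝ) ^ 2 := by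
        rw [le_div_iff₀ (by positivity)]; gcongr
      have h3 := hM y hyb
      have h4 := h0 _ (hrefl _ y hyb hyi)
      simp only [hg]; linarith
    · have := hgb0 y hyb hyi0; linarith
  · rw [hA, Finset.mem_filter, mem_ball]
    have n1 : nq (sv i : V d) = 1 := by
      have := nq_add (0 : V d) i; rw [zero_add, nq_zero] at this; simpa using this
    rw [n1]
    exact ⟨by nlinarith, by simp [sv]⟩

lemma grad_abs (i : Fin d) {R : ℕ} (hR : 1 ≤ R) (h : V d → ℝ) (M : ℝ)
    (h0 : ∀ x ∈ ball d (R + 1 : ℕ), 0 ≤ h x) (hM : ∀ x ∈ ball d (R + 1 : ℕ), h x ≤ M)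
    (hh : ∀ x ∈ ball d R, L h x = 0) : |h (sv i) - h 0| ≤ M * (d + 1) / R := by
  rw [abs_le]
  constructor
  · have := grad_one i hR (fun x => M - h x) M (fun x hx => by linarith [hM x hx])
      (fun x hx => by linarith [h0 x hx]) (fun x hx => by
        have := L_sub (fun _ => M) h x
        rw [this, hh x hx]; simp [L]; ring)
    linarith
  · exact grad_one i hR h M h0 hM hh

lemma grad_nb {R j k : ℕ} (hR : 1 ≤ R) (hj : j + R + 1 ≤ k) (h : V d → ℝ) (M : ℝ)
    (h0 : ∀ x, 0 ≤ h x) (hM : ∀ x ∈ ball d k, h x ≤ M)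
    (hh : ∀ x ∈ ball d k, L h x = 0) {x y : V d} (hx : x ∈ ball d j) (hy : y ∈ ball d j)
    (hn : Nb y x) : |h x - h y| ≤ M * (d + 1) / R := by
  have main : ∀ i, ∀ z ∈ ball d j, |h (z + sv i) - h z| ≤ M * (d + 1) / R := by
    intro i z hz
    have := grad_abs i hR (fun w => h (z + w)) M (fun w _ => h0 _)
      (fun w hw => hM _ (tri_mem hz hw (by omega))) (fun w hw => by
        rw [L_trans]; exact hh _ (tri_mem hz hw (by omega)))
    rwa [add_zero] at this
  obtain ⟨i, rfl | rfl⟩ := hn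
  · exact main i y hy
  · have := main i _ hx
    rw [sub_add_cancel, abs_sub_comm] at this
    exact this

lemma lip_l1 {R j k : ℕ} (hR : 1 ≤ R) (hj : j + R + 1 ≤ k) (h : V d → ℝ) (M : ℝ)
    (h0 : ∀ x, 0 ≤ h x) (hM : ∀ x ∈ ball d k, h x ≤ M)
    (hh : ∀ x ∈ ball d k, L h x = 0) : ∀ (l : ℕ) (x : V d), l1 x = l → x ∈ ball d j →
    |h x - h 0| ≤ l * (M * (d + 1) / R) := by
  intro l
  induction l with
  | zero => intro x hx _; rw [l1_eq_zero hx]; simp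
  | succ l ih =>
    intro x hx hb
    have hne : x ≠ 0 := by rintro rfl; simp [l1] at hx
    obtain ⟨y, hy1, hy2, hy3⟩ := l1_step hne
    have hyb : y ∈ ball d j := by rw [mem_ball] at *; linarith
    have h1 := ih y (by omega) hyb
    have h2 := grad_nb hR hj h M h0 hM hh hb hyb hy1
    have h3 := abs_add_le (h x - h y) (h y - h 0)
    rw [sub_add_sub_cancel] at h3
    push_cast; linarith

lemma l1_le_sqrt (x : V d) : (l1 x : ℝ) ≤ d * Real.sqrt (nq x) := by
  unfold l1
  push_cast [Nat.cast_natAbs]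
  calc ∑ i, |(x i : ℝ)| ≤ ∑ _i : Fin d, Real.sqrt (nq x) :=
        Finset.sum_le_sum fun i _ => abs_le_sqrt_nq x i
    _ = _ := by simp

lemma lip (hd : 1 ≤ d) : ∃ C : ℝ, 0 < C ∧ ∃ n1 : ℕ, ∀ n : ℕ, n1 ≤ n → ∀ h : V d → ℝ,
    (∀ x, 0 ≤ h x) → (∀ x ∈ ball d n, L h x = 0) →
    ∀ x, -(C / n * Real.sqrt (nq x + 1) * h 0) ≤ h x - h 0 := by
  obtain ⟨C, hC, n1, H⟩ := harnack hd
  have hd' : (1 : ℝ) ≤ d := by exact_mod_cast hd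
  refine ⟨8 * (C * d * (d + 1)) + 8, by positivity, max n1 20, ?_⟩
  intro n hn h h0 hh x
  have hn1 : n1 ≤ n := (le_max_left _ _).trans hn
  have hn20 : 20 ≤ n := (le_max_right _ _).trans hn
  have hn0 : (0 : ℝ) < n := by have : 0 < n := by omega
                               exact_mod_cast this
  obtain ⟨k, hk⟩ : ∃ k, k = (n - 1) / 2 := ⟨_, rfl⟩
  obtain ⟨R, hR⟩ : ∃ R, R = k / 2 := ⟨_, rfl⟩
  obtain ⟨j, hj⟩ : ∃ j, j = k - R - 1 := ⟨_, rfl⟩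
  have hM := H n k hn1 (by omega) (by omega) h h0 hh
  have hhk : ∀ x ∈ ball d k, L h x = 0 := fun x hx => hh x (ball_mono (by omega) hx)
  have hR8 : (n : ℝ) / 8 ≤ R := by
    rw [div_le_iff₀ (by norm_num)]; have : n ≤ R * 8 := by omega
    exact_mod_cast this
  have hj8 : (n : ℝ) / 8 ≤ j := by
    rw [div_le_iff₀ (by norm_num)]; have : n ≤ j * 8 := by omega
    exact_mod_cast this
  have hh0 := h0 0
  have hq := nq_nonneg x
  have hs : Real.sqrt (nq x) ≤ Real.sqrt (nq x + 1) := Real.sqrt_le_sqrt (by linarith)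
  have hs0 := Real.sqrt_nonneg (nq x)
  have e : (8 * (C * d * (d + 1)) + 8) / n * Real.sqrt (nq x + 1) * h 0 =
    8 * (C * d * (d + 1)) / n * Real.sqrt (nq x + 1) * h 0 +
      8 / n * Real.sqrt (nq x + 1) * h 0 := by ring
  have e1 : 0 ≤ 8 * (C * d * (d + 1)) / n * Real.sqrt (nq x + 1) * h 0 := by positivity
  have e2 : 0 ≤ 8 / n * Real.sqrt (nq x + 1) * h 0 := by positivity
  by_cases hx : x ∈ ball d j
  · have h1 := lip_l1 (by omega) (by omega) h (C * h 0) h0 hM hhk _ x rfl hx (R := R)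
    have h2 : (l1 x : ℝ) * (C * h 0 * (d + 1) / R) ≤
        (d * Real.sqrt (nq x + 1)) * (C * h 0 * (d + 1) / (n / 8)) := by
      gcongr
      exact (l1_le_sqrt x).trans (by gcongr)
    have h3 : (d * Real.sqrt (nq x + 1)) * (C * h 0 * (d + 1) / (n / 8)) =
      8 * (C * d * (d + 1)) / n * Real.sqrt (nq x + 1) * h 0 := by field_simp
    have h4 := (abs_le.mp h1).1
    linarith
  · rw [mem_ball] at hx
    push Not at hx
    have h1 : (j : ℝ) ≤ Real.sqrt (nq x) := Real.le_sqrt_of_sq_le hx.le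
    have h2 : 1 ≤ 8 / n * Real.sqrt (nq x + 1) := by
      rw [div_mul_eq_mul_div, le_div_iff₀ hn0]; linarith
    have h3 := mul_le_mul_of_nonneg_right h2 hh0
    have := h0 x
    linarith

end UIDLA


namespace UIDLA

variable {d : ℕ}

lemma mem_box {x : V d} {r : ℕ} (hx : x ∈ ball d r) (i : Fin d) :
    x i ∈ Finset.Icc (-(r : ℤ)) r := by
  rw [mem_ball] at hx
  have h := abs_le_of_sq_le_sq ((sq_le_nq x i).trans hx) (by positivity)
  have := abs_le.mp (show |x i| ≤ (r : ℤ) by exact_mod_cast h)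
  rw [Finset.mem_Icc]; exact this

lemma nq_upd (x : V d) (i : Fin d) (c : ℤ) :
    nq (Function.update x i c) = nq x - (x i : ℝ) ^ 2 + (c : ℝ) ^ 2 := by
  have e : Function.update x i c = x + (c - x i) • sv i := by
    funext j; by_cases h : j = i
    · subst h; simp [sv]
    · simp [h, sv]
  rw [e, nq_update]; push_cast; ring

lemma sep_aux {D r s a b : ℝ} (hD : 1 ≤ D) (hab : 0 ≤ b) (hlt : b < a)
    (h1 : s + a ^ 2 ≤ r ^ 2) (h2 : (r - 1) ^ 2 + 1 ≤ s + b ^ 2) (h3 : s + b ^ 2 ≤ D * b ^ 2)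
    : a - b < D := by
  have hb : r - 1 < D * b := by
    have : (r - 1) ^ 2 < (D * b) ^ 2 := by
      have : D * b ^ 2 ≤ (D * b) ^ 2 := by
        rw [mul_pow]; gcongr; nlinarith
      linarith
    exact lt_of_pow_lt_pow_left₀ 2 (by positivity) this
  by_contra hcon
  push Not at hcon
  nlinarith [mul_le_mul_of_nonneg_right hcon (show 0 ≤ a + b by linarith)]

open Classical in
lemma shell_dir (i : Fin d) {r : ℕ} (hr : 1 ≤ r) :
    ((ball d r \ ball d (r - 1 : ℕ)).filter (fun x => nq x ≤ d * (x i : ℝ) ^ 2)).card ≤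
      (2 * r + 1) ^ (d - 1) * (2 * d) := by
  have hd : 1 ≤ d := by have := i.2; omega
  have hd' : (1 : ℝ) ≤ d := by exact_mod_cast hd
  set P : Finset (V d) := Fintype.piFinset (fun j => if j = i then {0} else Finset.Icc (-(r : ℤ)) r) with hP
  have hcard : P.card = (2 * r + 1) ^ (d - 1) := by
    rw [hP, Fintype.card_piFinset, ← Finset.mul_prod_erase _ _ (Finset.mem_univ i),
      Finset.prod_congr rfl (g := fun _ => 2 * r + 1)]
    · simp
    · intro j hj
      rw [if_neg (Finset.ne_of_mem_erase hj)]; simp; omega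
  have := Finset.card_le_card_of_injOn
    (s := (ball d r \ ball d (r - 1 : ℕ)).filter (fun x => nq x ≤ d * (x i : ℝ) ^ 2))
    (t := P ×ˢ ((Finset.univ : Finset Bool) ×ˢ Finset.Ico (0 : ℤ) d))
    (fun x => (Function.update x i 0, (decide (0 ≤ x i), x i % d))) ?_ ?_
  · rw [Finset.card_product, Finset.card_product, hcard] at this
    simpa using this
  · intro x hx
    simp only [Finset.coe_filter, Finset.mem_sdiff, Set.mem_ofPred_eq] at hx
    simp only [Finset.coe_product, Set.mem_prod, Finset.mem_coe]
    refine ⟨?_, Finset.mem_univ _, ?_⟩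
    · rw [hP, Fintype.mem_piFinset]
      intro j
      by_cases hj : j = i
      · subst hj; simp
      · rw [if_neg hj]; simp only [Function.update_of_ne hj]; exact mem_box hx.1.1 j
    · rw [Finset.mem_Ico]
      exact ⟨Int.emod_nonneg _ (by omega), Int.emod_lt_of_pos _ (by omega)⟩
  · intro x hx y hy hxy
    simp only [Finset.coe_filter, Finset.mem_sdiff, Set.mem_ofPred_eq, mem_ball] at hx hy
    simp only [Prod.mk.injEq] at hxy
    obtain ⟨e1, e2, e3⟩ := hxy
    have hcast : ((r - 1 : ℕ) : ℝ) = r - 1 := by push_cast [hr]; ring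
    rw [hcast] at hx hy
    have hinn : ∀ z : V d, ¬ nq z ≤ ((r : ℝ) - 1) ^ 2 → ((r : ℝ) - 1) ^ 2 + 1 ≤ nq z := by
      intro z hz
      push Not at hz
      have e : nq z = ((∑ i, (z i) ^ 2 : ℤ) : ℝ) := by unfold nq; push_cast; rfl
      rw [e] at hz ⊢
      have : ((r : ℤ) - 1) ^ 2 < ∑ i, (z i) ^ 2 := by exact_mod_cast hz
      exact_mod_cast this
    have u1 := nq_upd x i 0
    have u2 := nq_upd y i 0
    rw [e1, u2] at u1
    have heq : x i = y i := by
      have hr' : (1 : ℝ) ≤ r := by exact_mod_cast hr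
      have hdiv : (d : ℤ) ∣ x i - y i := Int.ModEq.dvd (Int.ModEq.symm e3)
      have hsign : (0 ≤ x i ↔ 0 ≤ y i) := by simpa using e2
      have sep := fun (a b : V d) (ha : nq a ≤ (r : ℝ) ^ 2) (hb : ((r : ℝ) - 1) ^ 2 + 1 ≤ nq b)
        (hb2 : nq b ≤ d * (b i : ℝ) ^ 2) (hs : nq a - (a i : ℝ) ^ 2 = nq b - (b i : ℝ) ^ 2)
        (hlt : |(b i : ℝ)| < |(a i : ℝ)|) =>
        sep_aux (D := d) (r := r) (s := nq a - (a i : ℝ) ^ 2) (a := |(a i : ℝ)|) (b := |(b i : ℝ)|) hd'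
          (abs_nonneg _) hlt (by rw [sq_abs]; linarith) (by rw [sq_abs]; linarith)
          (by rw [sq_abs]; linarith)
      have habs : |x i| = |y i| := by
        rcases lt_trichotomy |x i| |y i| with h | h | h
        · exfalso
          have := sep y x hy.1.1 (hinn x hx.1.2) hx.2 (by simpa using u1) (by exact_mod_cast h)
          have this2 : |y i| - |x i| < d := by exact_mod_cast this
          have hlt : |x i - y i| < d := by
            by_cases h0 : 0 ≤ x i
            · have := hsign.mp h0
              rw [abs_of_nonneg h0, abs_of_nonneg this] at *
              rw [abs_of_nonpos (by omega)]; omega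
            · have : ¬ 0 ≤ y i := fun hh => h0 (hsign.mpr hh)
              push Not at this h0
              rw [abs_of_neg h0, abs_of_neg this] at *
              rw [abs_of_nonneg (by omega)]; omega
          have := Int.eq_zero_of_abs_lt_dvd hdiv hlt
          rw [sub_eq_zero.mp this] at h; omega
        · exact h
        · exfalso
          have := sep x y hx.1.1 (hinn y hy.1.2) hy.2 (by simpa using u1.symm) (by exact_mod_cast h)
          have this2 : |x i| - |y i| < d := by exact_mod_cast this
          have hlt : |x i - y i| < d := by
            by_cases h0 : 0 ≤ x i
            · have := hsign.mp h0
              rw [abs_of_nonneg h0, abs_of_nonneg this] at *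
              rw [abs_of_nonneg (by omega)]; omega
            · have : ¬ 0 ≤ y i := fun hh => h0 (hsign.mpr hh)
              push Not at this h0
              rw [abs_of_neg h0, abs_of_neg this] at *
              rw [abs_of_nonpos (by omega)]; omega
          have := Int.eq_zero_of_abs_lt_dvd hdiv hlt
          rw [sub_eq_zero.mp this] at h; omega
      by_cases h0 : 0 ≤ x i
      · have := hsign.mp h0
        rwa [abs_of_nonneg h0, abs_of_nonneg this] at habs
      · have : ¬ 0 ≤ y i := fun hh => h0 (hsign.mpr hh)
        push Not at this h0
        rw [abs_of_neg h0, abs_of_neg this] at habs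
        omega
    funext j
    by_cases hj : j = i
    · rw [hj, heq]
    · have := congrFun e1 j
      simpa [hj] using this

lemma shell (hd : 1 ≤ d) {r : ℕ} (hr : 1 ≤ r) :
    (bn d r : ℝ) - bn d (r - 1) ≤ d * (2 * d) * 3 ^ (d - 1) * (r : ℝ) ^ (d - 1) := by
  classical
  have hs : ball d (r - 1 : ℕ) ⊆ ball d r := ball_mono (by omega)
  have h1 : (bn d r : ℝ) - bn d (r - 1) = ((ball d r \ ball d (r - 1 : ℕ)).card : ℝ) := by
    rw [Finset.card_sdiff_of_subset hs, Nat.cast_sub (Finset.card_le_card hs)]; rfl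
  rw [h1]
  have h2 : ball d r \ ball d (r - 1 : ℕ) ⊆ Finset.univ.biUnion (fun i : Fin d =>
      (ball d r \ ball d (r - 1 : ℕ)).filter (fun x => nq x ≤ d * (x i : ℝ) ^ 2)) := by
    intro x hx
    rw [Finset.mem_biUnion]
    by_contra hcon
    push Not at hcon
    have : ∀ i : Fin d, d * (x i : ℝ) ^ 2 < nq x := by
      intro i
      have := hcon i (Finset.mem_univ i)
      rw [Finset.mem_filter] at this
      push Not at this
      exact this hx
    have hne : (Finset.univ : Finset (Fin d)).Nonempty := ⟨⟨0, hd⟩, Finset.mem_univ _⟩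
    have := Finset.sum_lt_sum_of_nonempty hne (fun i _ => this i)
    rw [← Finset.mul_sum] at this
    simp at this
    exact lt_irrefl _ this
  have h3 : (ball d r \ ball d (r - 1 : ℕ)).card ≤ d * ((2 * r + 1) ^ (d - 1) * (2 * d)) := by
    refine (Finset.card_le_card h2).trans (Finset.card_biUnion_le.trans ?_)
    refine (Finset.sum_le_sum fun i _ => shell_dir i hr).trans ?_
    simp
  have h4 : ((ball d r \ ball d (r - 1 : ℕ)).card : ℝ) ≤ d * ((2 * r + 1) ^ (d - 1) * (2 * d)) := by
    exact_mod_cast h3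
  refine h4.trans ?_
  have hr' : (1 : ℝ) ≤ r := by exact_mod_cast hr
  have : (2 * (r : ℝ) + 1) ^ (d - 1) ≤ 3 ^ (d - 1) * (r : ℝ) ^ (d - 1) := by
    rw [← mul_pow]; gcongr; linarith
  calc _ ≤ d * (3 ^ (d - 1) * (r : ℝ) ^ (d - 1) * (2 * d)) := by gcongr
    _ = _ := by ring

lemma bn_lower (hd : 1 ≤ d) (n : ℕ) : (n : ℝ) ^ d ≤ (d : ℝ) ^ d * bn d n := by
  have hd' : (1 : ℝ) ≤ d := by exact_mod_cast hd
  set k := n / d with hk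
  have hsub : Fintype.piFinset (fun _ : Fin d => Finset.Icc (-(k : ℤ)) k) ⊆ ball d n := by
    intro x hx
    rw [Fintype.mem_piFinset] at hx
    rw [mem_ball]
    have h1 : ∀ i, (x i : ℝ) ^ 2 ≤ (k : ℝ) ^ 2 := by
      intro i
      have := Finset.mem_Icc.mp (hx i)
      rw [sq_le_sq, abs_of_nonneg (show (0:ℝ) ≤ k by positivity)]
      have : |x i| ≤ (k : ℤ) := abs_le.mpr this
      exact_mod_cast this
    have h2 : (d : ℝ) * k ≤ n := by exact_mod_cast Nat.mul_div_le n d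
    calc nq x ≤ ∑ _i : Fin d, (k : ℝ) ^ 2 := Finset.sum_le_sum fun i _ => h1 i
      _ = d * (k : ℝ) ^ 2 := by simp
      _ ≤ (d * k) ^ 2 := by
          rw [mul_pow]; gcongr; nlinarith
      _ ≤ _ := by gcongr
  have hc := Finset.card_le_card hsub
  rw [Fintype.card_piFinset] at hc
  simp only [Int.card_Icc, Finset.prod_const, Finset.card_univ, Fintype.card_fin] at hc
  have e : ((k : ℤ) + 1 - -(k : ℤ)).toNat = 2 * k + 1 := by omega
  rw [e] at hc
  have hn : n ≤ d * (2 * k + 1) := by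
    have := Nat.div_add_mod n d
    have := Nat.mod_lt n (show d > 0 by omega)
    rw [← hk] at *
    nlinarith
  have : n ^ d ≤ d ^ d * bn d n := by
    calc n ^ d ≤ (d * (2 * k + 1)) ^ d := Nat.pow_le_pow_left hn d
      _ = d ^ d * (2 * k + 1) ^ d := mul_pow _ _ _
      _ ≤ _ := Nat.mul_le_mul_left _ hc
  exact_mod_cast this

lemma summ (s : ℝ) (hs : 1 / 2 < s) : Summable fun k : ℤ => (1 + (k : ℝ) ^ 2) ^ (-s) := by
  have h1 : Summable fun k : ℤ => |(k : ℝ)| ^ (-(2 * s)) :=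
    Real.summable_abs_int_rpow (by linarith)
  have h2 : Summable fun k : ℤ => (if k = 0 then (1:ℝ) else 0) :=
    summable_of_ne_finset_zero (s := {0}) (by intro b hb; simp at hb; simp [hb])
  refine Summable.of_nonneg_of_le (fun k => by positivity) (fun k => ?_) (h1.add h2)
  by_cases hk : k = 0
  · subst hk
    simp
    positivity
  · rw [if_neg hk, add_zero]
    have hk' : 0 < |(k : ℝ)| := by simpa using hk
    rw [show -(2 * s) = 2 * (-s) by ring, Real.rpow_mul (abs_nonneg _)]
    apply Real.rpow_le_rpow_of_nonpos
    · positivity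
    · rw [← sq_abs]; norm_num
    · linarith

lemma rho_sum (hd : 1 ≤ d) : ∃ K : ℝ, 0 < K ∧ ∀ r : ℕ,
    ∑ x ∈ ball d r, rho x * Real.sqrt (nq x + 1) ≤ K := by
  have hd' : (1 : ℝ) ≤ d := by exact_mod_cast hd
  set s : ℝ := ((d : ℝ) + 1) / (2 * d) with hs
  have hs2 : 1 / 2 < s := by
    rw [hs, div_lt_div_iff₀ (by norm_num) (by positivity)]; linarith
  have hsum := summ s hs2
  refine ⟨(∑' k : ℤ, (1 + (k : ℝ) ^ 2) ^ (-s)) ^ d + 1, by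
    have : 0 ≤ ∑' k : ℤ, (1 + (k : ℝ) ^ 2) ^ (-s) := tsum_nonneg fun k => by positivity
    positivity, fun r => ?_⟩
  have h1 : ∀ x : V d, rho x * Real.sqrt (nq x + 1) ≤ ∏ i, (1 + (x i : ℝ) ^ 2) ^ (-s) := by
    intro x
    have hq := nq_nonneg x
    have ha := aa_ge d
    have a1 : rho x ≤ (nq x + 1) ^ (-((d / 2 : ℝ) + 1)) := by
      unfold rho
      apply Real.rpow_le_rpow_of_nonpos <;> first | positivity | skip
      · linarith
      · have : 0 ≤ (d : ℝ) / 2 + 1 := by positivity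
        linarith
    have a2 : (nq x + 1) ^ (-((d / 2 : ℝ) + 1)) * Real.sqrt (nq x + 1) = ((nq x + 1) ^ d) ^ (-s) := by
      rw [Real.sqrt_eq_rpow, ← Real.rpow_add (by positivity), ← Real.rpow_natCast,
        ← Real.rpow_mul (by positivity)]
      congr 1; rw [hs]; field_simp; ring
    have a3 : ∏ i, (1 + (x i : ℝ) ^ 2) ≤ (nq x + 1) ^ d := by
      calc ∏ i, (1 + (x i : ℝ) ^ 2) ≤ ∏ _i : Fin d, (nq x + 1) :=
            Finset.prod_le_prod (fun i _ => by positivity) (fun i _ => by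
              have := sq_le_nq x i; linarith)
        _ = _ := by simp
    have a4 : 0 < ∏ i, (1 + (x i : ℝ) ^ 2) := Finset.prod_pos fun i _ => by positivity
    calc rho x * Real.sqrt (nq x + 1) ≤ (nq x + 1) ^ (-((d / 2 : ℝ) + 1)) * Real.sqrt (nq x + 1) := by
          gcongr
      _ = ((nq x + 1) ^ d) ^ (-s) := a2
      _ ≤ (∏ i, (1 + (x i : ℝ) ^ 2)) ^ (-s) :=
          Real.rpow_le_rpow_of_nonpos a4 a3 (by linarith)
      _ = _ := by
          rw [← Real.finsetProd_rpow]
          intro i _; positivity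
  calc ∑ x ∈ ball d r, rho x * Real.sqrt (nq x + 1)
      ≤ ∑ x ∈ ball d r, ∏ i, (1 + (x i : ℝ) ^ 2) ^ (-s) := Finset.sum_le_sum fun x _ => h1 x
    _ ≤ ∑ x ∈ Fintype.piFinset (fun _ : Fin d => Finset.Icc (-(r : ℤ)) r),
          ∏ i, (1 + (x i : ℝ) ^ 2) ^ (-s) := by
        apply Finset.sum_le_sum_of_subset_of_nonneg
        · intro x hx; rw [Fintype.mem_piFinset]; exact mem_box hx
        · intro x _ _; exact Finset.prod_nonneg fun i _ => by positivity
    _ = ∏ _i : Fin d, ∑ k ∈ Finset.Icc (-(r : ℤ)) r, (1 + (k : ℝ) ^ 2) ^ (-s) := by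
        rw [Finset.prod_univ_sum]
    _ = (∑ k ∈ Finset.Icc (-(r : ℤ)) r, (1 + (k : ℝ) ^ 2) ^ (-s)) ^ d := by simp
    _ ≤ (∑' k : ℤ, (1 + (k : ℝ) ^ 2) ^ (-s)) ^ d := by
        gcongr
        exact hsum.sum_le_tsum _ (fun k _ => by positivity)
    _ ≤ _ := by linarith

lemma mm_le {r n : ℕ} (hr : r ≤ n) (hn : 1 ≤ n) :
    mm d r ≤ (1 + aa d) ^ (d / 2 : ℝ) * (n : ℝ) ^ d := by
  have ha := aa_ge d
  have hn' : (1 : ℝ) ≤ n := by exact_mod_cast hn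
  have hr' : (r : ℝ) ≤ n := by exact_mod_cast hr
  unfold mm
  calc ((r : ℝ) ^ 2 + aa d) ^ (d / 2 : ℝ) ≤ ((1 + aa d) * (n : ℝ) ^ 2) ^ (d / 2 : ℝ) := by
        apply Real.rpow_le_rpow (by positivity) _ (by positivity)
        have : (r : ℝ) ^ 2 ≤ (n : ℝ) ^ 2 := by gcongr
        have : (1 : ℝ) ≤ (n : ℝ) ^ 2 := one_le_pow₀ hn'
        nlinarith
    _ = (1 + aa d) ^ (d / 2 : ℝ) * ((n : ℝ) ^ 2) ^ (d / 2 : ℝ) := by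
        rw [Real.mul_rpow (by positivity) (by positivity)]
    _ = _ := by
        congr 1
        rw [← Real.rpow_natCast (n : ℝ) 2, ← Real.rpow_mul (by positivity), ← Real.rpow_natCast]
        congr 1; push_cast; ring

lemma C1_ge (hd : 1 ≤ d) : 1 ≤ C1 d := by
  unfold C1
  have hd' : (1 : ℝ) ≤ d := by exact_mod_cast hd
  have : (1 : ℝ) ≤ 4 ^ ((d / 2 : ℝ) + 1) := Real.one_le_rpow (by norm_num) (by positivity)
  nlinarith

lemma analytic (hd : 1 ≤ d) : ∃ C : ℝ, 0 < C ∧ ∃ N : ℕ, ∀ n : ℕ, N ≤ n → ∀ h : V d → ℝ,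
    (∀ x, 0 ≤ h x) → (∀ x ∈ ball d n, L h x = 0) →
    (bn d n : ℝ) * (1 - C / n) * h 0 ≤ ∑ x ∈ ball d n, h x := by
  obtain ⟨Cl, hCl, n1, Hl⟩ := lip hd
  obtain ⟨K, hK, HK⟩ := rho_sum hd
  have hd' : (1 : ℝ) ≤ d := by exact_mod_cast hd
  have hC1 := C1_ge hd
  have hCG := CG_nonneg d
  have ha := aa_ge d
  set Cs : ℝ := d * (2 * d) * 3 ^ (d - 1) with hCs
  have hCs0 : 0 ≤ Cs := by positivity
  set E1 : ℝ := (1 + aa d) ^ (d / 2 : ℝ) * CG d * Cl * K with hE1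
  have hE10 : 0 ≤ E1 := by positivity
  set E : ℝ := E1 + C1 d * Cs + C1 d * Cs + bn d 1 with hE
  have hE0 : 0 ≤ E := by positivity
  refine ⟨E * (d : ℝ) ^ d + 1, by positivity, max n1 2, ?_⟩
  intro n hn h h0 hh
  have hn1 : n1 ≤ n := (le_max_left _ _).trans hn
  have hn2 : 2 ≤ n := (le_max_right _ _).trans hn
  have hnr : (1 : ℝ) ≤ n := by exact_mod_cast (by omega : 1 ≤ n)
  have hh0 := h0 0
  have hl := Hl n hn1 h h0 hh
  set Q : ℝ := (n : ℝ) ^ (d - 1) with hQ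
  have hQ1 : 1 ≤ Q := one_le_pow₀ hnr
  have hnd : (n : ℝ) ^ d = n * Q := by rw [hQ, ← pow_succ']; congr 1; omega
  have hD : ∀ r : ℕ, ∑ x ∈ ball d r, (h x - h 0) = ∑ x ∈ ball d r, h x - bn d r * h 0 := by
    intro r; rw [Finset.sum_sub_distrib, Finset.sum_const, nsmul_eq_mul]; rfl
  have hsh : ∀ r : ℕ, 1 ≤ r → r ≤ n → (bn d r : ℝ) - bn d (r - 1) ≤ Cs * Q := by
    intro r hr1 hrn
    refine (shell hd hr1).trans ?_
    have : (r : ℝ) ≤ n := by exact_mod_cast hrn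
    rw [hQ]; gcongr
  have main : ∀ r : ℕ, 1 ≤ r → r ≤ n → -(E * Q * h 0) ≤ ∑ x ∈ ball d r, (h x - h 0) := by
    intro r hr1
    induction r, hr1 using Nat.le_induction with
    | base =>
      intro _
      rw [hD]
      have h1 : 0 ≤ ∑ x ∈ ball d (1 : ℕ), h x := Finset.sum_nonneg fun x _ => h0 x
      have h2 : (bn d 1 : ℝ) * h 0 ≤ E * Q * h 0 := by
        gcongr
        have : (bn d 1 : ℝ) ≤ E := by
          rw [hE]
          have : 0 ≤ C1 d * Cs := by positivity
          linarith
        nlinarith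
      linarith
    | succ r hr1 ih =>
      intro hrn
      have ih := ih (by omega)
      have hrec := recursion hd hr1 h h0 (fun x hx => hh x (ball_mono (by omega) hx)) (Cl / n)
        (by positivity) (fun x _ => hl x)
      have a1 : mm d r * CG d * (Cl / n) * h 0 * ∑ x ∈ ball d r, rho x * Real.sqrt (nq x + 1) ≤
          E1 * Q * h 0 := by
        calc mm d r * CG d * (Cl / n) * h 0 * ∑ x ∈ ball d r, rho x * Real.sqrt (nq x + 1)
            ≤ ((1 + aa d) ^ (d / 2 : ℝ) * (n : ℝ) ^ d) * CG d * (Cl / n) * h 0 * K := by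
              have := mm_le (d := d) (show r ≤ n by omega) (by omega)
              have := HK r
              have := mm_pos d r
              gcongr
              exact Finset.sum_nonneg fun x _ => mul_nonneg (rho_pos x).le (Real.sqrt_nonneg _)
          _ = _ := by
              rw [hnd, hE1]; field_simp
      have s1 := hsh r hr1 (by omega)
      have s2 := hsh (r + 1) (by omega) hrn
      rw [Nat.add_sub_cancel] at s2
      have d1 := hD r
      have d2 := hD (r + 1)
      set D0 := ∑ x ∈ ball d r, (h x - h 0)
      set D1 := ∑ x ∈ ball d (r + 1 : ℕ), (h x - h 0)
      have b1 : 2 * d * C1 d * h 0 * ((bn d r : ℝ) - bn d (r - 1)) ≤ 2 * d * C1 d * h 0 * (Cs * Q) := by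
        gcongr
      have b2 : 2 * d * C1 d * h 0 * ((bn d (r + 1) : ℝ) - bn d r) ≤ 2 * d * C1 d * h 0 * (Cs * Q) := by
        gcongr
      have a2 : E1 * Q * h 0 ≤ 2 * d * (E1 * Q * h 0) := by
        have : 0 ≤ E1 * Q * h 0 := by positivity
        nlinarith
      have tot : 0 ≤ 2 * d * (D0 + E1 * Q * h 0 + C1 d * h 0 * (Cs * Q) + C1 d * (D1 - D0)
          + C1 d * h 0 * (Cs * Q)) := by
        have : 2 * d * C1 d * (∑ x ∈ ball d (r + 1 : ℕ), h x - ∑ x ∈ ball d r, h x) =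
          2 * d * C1 d * (D1 - D0) + 2 * d * C1 d * h 0 * ((bn d (r + 1) : ℝ) - bn d r) := by
          rw [d1, d2]; ring
        linarith
      have tot2 := nonneg_of_mul_nonneg_right tot (by positivity : (0:ℝ) < 2 * d)
      have e3 : 0 ≤ (bn d 1 : ℝ) * Q * h 0 := by positivity
      have e4 : E * Q * h 0 = E1 * Q * h 0 + C1 d * h 0 * (Cs * Q) + C1 d * h 0 * (Cs * Q) +
        (bn d 1 : ℝ) * Q * h 0 := by rw [hE]; ring
      have e5 : (C1 d - 1) * (-(E * Q * h 0)) ≤ (C1 d - 1) * D0 :=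
        mul_le_mul_of_nonneg_left ih (by linarith)
      have e6 : C1 d * (-(E * Q * h 0)) ≤ C1 d * D1 := by linarith
      exact le_of_mul_le_mul_left e6 (by linarith)
  have fin := main n (by omega) le_rfl
  rw [hD] at fin
  have hb := bn_lower hd n
  rw [hnd] at hb
  have hb2 : E * Q * h 0 ≤ bn d n * ((E * (d : ℝ) ^ d + 1) / n) * h 0 := by
    refine mul_le_mul_of_nonneg_right ?_ hh0
    rw [← mul_div_assoc, le_div_iff₀ (by positivity)]
    have := mul_le_mul_of_nonneg_left hb hE0
    have : 0 ≤ (bn d n : ℝ) := by positivity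
    linarith
  linarith

end UIDLA

namespace UIDLA

noncomputable def coin : Measure Bool := (2⁻¹ : ℝ≥0∞) • Measure.count

theorem coin_singleton (b : Bool) : coin {b} = 2⁻¹ := by
  simp [coin]

instance : IsProbabilityMeasure coin := ⟨by
  have : (Set.univ : Set Bool) = {true} ∪ {false} := by ext b; cases b <;> simp
  rw [this, measure_union (by simp) (measurableSet_singleton _), coin_singleton, coin_singleton,
    ENNReal.inv_two_add_inv_two]⟩

instance : IsProbabilityMeasure μ0 := ⟨by simp [μ0]⟩

noncomputable def bits (x : ℝ) : ℕ → Bool := fun k => bit x k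

theorem measurable_bit (k : ℕ) : Measurable (fun x => bit x k) := by
  have : Measurable (fun z : ℤ => (z % 2 == 1)) := measurable_of_countable _
  exact this.comp (Int.measurable_floor.comp (measurable_id.mul_const _))

theorem measurable_bits : Measurable bits := measurable_pi_lambda _ measurable_bit

theorem floor_succ (x : ℝ) (k : ℕ) :
    ⌊x * 2 ^ (k+1)⌋ = 2 * ⌊x * 2 ^ k⌋ + (if bit x k then 1 else 0) := by
  have h1 : x * 2 ^ (k+1) = 2 * (x * 2^k) := by ring
  have h2 := Int.floor_le (x * 2^k)
  have h3 := Int.lt_floor_add_one (x * 2^k)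
  have h4 : 2 * ⌊x * 2 ^ k⌋ ≤ ⌊x * 2 ^ (k+1)⌋ := by
    rw [Int.le_floor, h1]; push_cast; linarith
  have h5 : ⌊x * 2 ^ (k+1)⌋ < 2 * ⌊x * 2 ^ k⌋ + 2 := by
    rw [Int.floor_lt, h1]; push_cast; linarith
  unfold bit
  simp only [beq_iff_eq]
  split_ifs with h <;> omega

/-- dyadic cylinder index -/
def cyl (c : ℕ → Bool) : ℕ → ℤ
  | 0 => 0
  | k + 1 => 2 * cyl c k + (if c k then 1 else 0)

theorem cyl_iff (c : ℕ → Bool) (x : ℝ) (hx : x ∈ Set.Ico (0:ℝ) 1) (n : ℕ) :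
    (∀ k < n, bit x k = c k) ↔ ⌊x * 2 ^ n⌋ = cyl c n := by
  induction n with
  | zero => simpa [cyl, Int.floor_eq_iff] using hx
  | succ n ih =>
    rw [floor_succ, cyl]
    constructor
    · intro h
      rw [ih.1 (fun k hk => h k (by omega)), h n (by omega)]
    · intro h
      have h6 : ⌊x * 2 ^ n⌋ = cyl c n := by
        split_ifs at h <;> omega
      have h7 : bit x n = c n := by
        rw [h6] at h
        cases h8 : bit x n <;> cases h9 : c n <;> simp_all
      intro k hk
      rcases Nat.lt_succ_iff_lt_or_eq.1 hk with hk | rfl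
      · exact ih.2 h6 k hk
      · exact h7

theorem cyl_bound (c : ℕ → Bool) (n : ℕ) : 0 ≤ cyl c n ∧ cyl c n + 1 ≤ 2 ^ n := by
  induction n with
  | zero => simp [cyl]
  | succ n ih => rw [cyl, pow_succ]; split_ifs <;> omega

theorem μ0_eq : μ0 = volume.restrict (Set.Ico (0:ℝ) 1) := by
  rw [μ0]; exact (Measure.restrict_congr_set Ico_ae_eq_Icc).symm

theorem ae_Ico : ∀ᵐ x ∂μ0, x ∈ Set.Ico (0:ℝ) 1 := by
  rw [μ0_eq]; exact ae_restrict_mem measurableSet_Ico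

theorem μ0_cyl (c : ℕ → Bool) (n : ℕ) : μ0 {x | ∀ k < n, bit x k = c k} = 2⁻¹ ^ n := by
  have h1 : {x | ∀ k < n, bit x k = c k} =ᵐ[μ0]
      Set.Ico ((cyl c n : ℝ) / 2 ^ n) ((cyl c n + 1 : ℝ) / 2 ^ n) := by
    filter_upwards [ae_Ico] with x hx
    apply propext
    change (∀ k < n, bit x k = c k) ↔ _
    rw [cyl_iff c x hx n, Int.floor_eq_iff]
    change _ ↔ _ ≤ _ ∧ _ < _
    rw [div_le_iff₀ (by positivity), lt_div_iff₀ (by positivity)]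
  rw [measure_congr h1, μ0_eq, Measure.restrict_apply measurableSet_Ico,
    Set.inter_eq_left.2, Real.volume_Ico]
  · rw [← sub_div, add_sub_cancel_left, one_div, ENNReal.ofReal_inv_of_pos (by positivity),
      ENNReal.ofReal_pow (by norm_num)]
    simp [ENNReal.inv_pow]
  · obtain ⟨h2, h3⟩ := cyl_bound c n
    have h2' : (0:ℝ) ≤ cyl c n := by exact_mod_cast h2
    have h3' : (cyl c n : ℝ) + 1 ≤ 2 ^ n := by exact_mod_cast h3
    intro x hx
    refine ⟨le_trans (by positivity) hx.1, hx.2.trans_le ?_⟩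
    rw [div_le_one (by positivity)]; exact h3'

noncomputable abbrev νc : Measure (ℕ → Bool) := Measure.infinitePi (fun _ : ℕ => coin)

theorem map_bits : μ0.map bits = νc := by
  have key : ∀ n : ℕ, (μ0.map bits).map (fun a (i : Fin n) => a i)
      = νc.map (fun a (i : Fin n) => a i) := by
    intro n
    have hm : Measurable (fun (a : ℕ → Bool) (i : Fin n) => a i) := by fun_prop
    refine Measure.ext_of_singleton (fun b => ?_)
    rw [Measure.map_apply hm (measurableSet_singleton _),
      Measure.map_apply hm (measurableSet_singleton _),
      Measure.map_apply measurable_bits (hm (measurableSet_singleton _))]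
    let c : ℕ → Bool := fun k => if h : k < n then b ⟨k, h⟩ else false
    have e1 : bits ⁻¹' ((fun (a : ℕ → Bool) (i : Fin n) => a i) ⁻¹' {b})
        = {x | ∀ k < n, bit x k = c k} := by
      ext x
      simp only [Set.mem_preimage, Set.mem_singleton_iff, funext_iff, bits, Fin.forall_iff]
      change _ ↔ ∀ k < n, bit x k = c k
      refine forall₂_congr fun k hk => ?_
      simp [c, hk]
    have e2 : ((fun (a : ℕ → Bool) (i : Fin n) => a i) ⁻¹' {b})
        = Set.pi (Finset.range n) (fun k => {c k}) := by
      ext a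
      simp only [Set.mem_preimage, Set.mem_singleton_iff, funext_iff, Fin.forall_iff, Set.mem_pi,
        Finset.coe_range, Set.mem_Iio]
      refine forall₂_congr fun k hk => ?_
      simp [c, hk]
    rw [e1, e2, μ0_cyl, Measure.infinitePi_pi _ (fun _ _ => measurableSet_singleton _)]
    simp [coin_singleton]
  have : IsProbabilityMeasure (μ0.map bits) :=
    Measure.isProbabilityMeasure_map measurable_bits.aemeasurable
  refine Measure.eq_infinitePi _ (fun s t ht => ?_)
  obtain ⟨n, hn⟩ : ∃ n, ∀ i ∈ s, i < n := ⟨s.sup id + 1, fun i hi =>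
    Nat.lt_succ_of_le (Finset.le_sup (f := id) hi)⟩
  have e3 : Set.pi s t = (fun (a : ℕ → Bool) (i : Fin n) => a i) ⁻¹'
      {b | ∀ i : Fin n, (i : ℕ) ∈ s → b i ∈ t i} := by
    ext a
    change (∀ i ∈ s, a i ∈ t i) ↔ ∀ i : Fin n, (i : ℕ) ∈ s → a i ∈ t i
    exact ⟨fun h i hi => h i hi, fun h i hi => h ⟨i, hn i hi⟩ hi⟩
  rw [← Measure.infinitePi_pi (μ := fun _ : ℕ => coin) (fun i hi => ht i), e3]
  have hm : Measurable (fun (a : ℕ → Bool) (i : Fin n) => a i) := by fun_prop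
  rw [← Measure.map_apply hm (Set.toFinite _).measurableSet,
    ← Measure.map_apply hm (Set.toFinite _).measurableSet, key]

noncomputable def val (a : ℕ → Bool) : ℝ :=
  ∑' j : ℕ, if a j then ((2 : ℝ) ^ (-(j : ℤ) - 1)) else 0

theorem val_summable (a : ℕ → Bool) :
    Summable (fun j : ℕ => if a j then ((2 : ℝ) ^ (-(j : ℤ) - 1)) else 0) := by
  have h : Summable (fun j : ℕ => (1/2 : ℝ) * (1/2) ^ j) :=
    (summable_geometric_of_lt_one (by norm_num) (by norm_num)).mul_left _
  refine Summable.of_nonneg_of_le (fun j => by split_ifs <;> positivity) (fun j => ?_) h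
  have : ((2 : ℝ) ^ (-(j : ℤ) - 1)) = (1/2 : ℝ) * (1/2) ^ j := by
    rw [zpow_sub₀ (by norm_num), zpow_neg]; simp; ring
  split_ifs
  · exact this.le
  · positivity

theorem measurable_val : Measurable val := by
  have h : Tendsto (fun (n : ℕ) (a : ℕ → Bool) => ∑ j ∈ Finset.range n,
      if a j then ((2 : ℝ) ^ (-(j : ℤ) - 1)) else 0) atTop (nhds val) := by
    rw [tendsto_pi_nhds]
    intro a
    exact (val_summable a).hasSum.tendsto_sum_nat
  refine measurable_of_tendsto_metrizable (fun n => ?_) h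
  refine Finset.measurable_sum _ (fun j _ => ?_)
  have : Measurable (fun b : Bool => if b then ((2 : ℝ) ^ (-(j : ℤ) - 1)) else 0) :=
    measurable_of_countable _
  exact this.comp (measurable_pi_apply j)

theorem val_bits (x : ℝ) (hx : x ∈ Set.Ico (0:ℝ) 1) : val (bits x) = x := by
  have h1 : ∀ n : ℕ, ∑ j ∈ Finset.range n, (if bits x j then ((2 : ℝ) ^ (-(j : ℤ) - 1)) else 0)
      = ⌊x * 2 ^ n⌋ / 2 ^ n := by
    intro n
    induction n with
    | zero =>
      have : ⌊x⌋ = 0 := Int.floor_eq_zero_iff.2 hx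
      simp [this]
    | succ n ih =>
      rw [Finset.sum_range_succ, ih, floor_succ]
      have : ((2 : ℝ) ^ (-(n : ℤ) - 1)) = 1 / 2 ^ (n+1) := by
        rw [zpow_sub₀ (by norm_num), zpow_neg, pow_succ]; simp; ring
      rw [this]
      unfold bits
      split_ifs
      · push_cast; rw [pow_succ]; field_simp
      · push_cast; rw [pow_succ]; field_simp; ring
  have h2 := (val_summable (bits x)).hasSum.tendsto_sum_nat
  refine tendsto_nhds_unique h2 ?_
  simp_rw [h1]
  have h3 : Tendsto (fun n : ℕ => x - (1/2 : ℝ) ^ n) atTop (nhds x) := by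
    simpa using (tendsto_pow_atTop_nhds_zero_of_lt_one (r := (1/2:ℝ)) (by norm_num)
      (by norm_num)).const_sub x
  refine tendsto_of_tendsto_of_tendsto_of_le_of_le h3 tendsto_const_nhds (fun n => ?_) (fun n => ?_)
  · have := Int.lt_floor_add_one (x * 2^n)
    change x - (1/2 : ℝ) ^ n ≤ _
    rw [le_div_iff₀ (by positivity), sub_mul, ← mul_pow]
    norm_num
    linarith
  · have := Int.floor_le (x * 2^n)
    change _ ≤ x
    rw [div_le_iff₀ (by positivity)]; exact this

theorem map_val : νc.map val = μ0 := by
  rw [← map_bits, Measure.map_map measurable_val measurable_bits]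
  have : val ∘ bits =ᵐ[μ0] id := by
    filter_upwards [ae_Ico] with x hx using val_bits x hx
  rw [Measure.map_congr this, Measure.map_id]

noncomputable abbrev Pinf : Measure (ℕ → ℝ) := Measure.infinitePi (fun _ : ℕ => μ0)

theorem uSlice_eq (x : ℝ) (i : ℕ) : uSlice x i = val (fun j => bits x (Nat.pair i j)) := rfl

theorem measurable_uSlice (i : ℕ) : Measurable (fun x => uSlice x i) := by
  simp_rw [uSlice_eq]
  refine measurable_val.comp (measurable_pi_lambda _ fun j => ?_)
  exact (measurable_pi_apply _).comp measurable_bits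

theorem measurable_slices : Measurable (fun x i => uSlice x i) :=
  measurable_pi_lambda _ measurable_uSlice

theorem map_slices : μ0.map (fun x i => uSlice x i) = Pinf := by
  have e : (fun x i => uSlice x i) = (fun (b : ℕ → ℕ → Bool) i => val (b i)) ∘
     (fun (a : ℕ → Bool) i j => a (Nat.pair i j)) ∘ bits := rfl
  have m1 : Measurable (fun (b : ℕ → ℕ → Bool) i => val (b i)) :=
    measurable_pi_lambda _ fun i => measurable_val.comp (measurable_pi_apply i)
  have m2 : Measurable (fun (a : ℕ → Bool) i j => a (Nat.pair i j)) := by fun_prop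
  rw [e, ← Measure.map_map m1 (m2.comp measurable_bits), ← Measure.map_map m2 measurable_bits,
    map_bits]
  have h1 : νc.map (fun (a : ℕ → Bool) i j => a (Nat.pair i j))
      = Measure.infinitePi (fun _ : ℕ => νc) := by
    have h2 := Measure.map_infinitePi_infinitePi_of_inj (P := fun _ : ℕ => coin)
      (f := fun p : ℕ × ℕ => Nat.pair p.1 p.2) (Nat.pairEquiv.injective)
    have h3 := Measure.infinitePi_map_curry (fun _ _ : ℕ => coin)
    rw [← h3, ← h2, Measure.map_map (MeasurableEquiv.measurable _) (by fun_prop)]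
    rfl
  rw [h1, Measure.infinitePi_map_pi]
  · simp [map_val]
  · intro; exact measurable_val

end UIDLA

namespace UIDLA
variable {d : ℕ}

theorem measurable_pick (S : Finset (V d)) : Measurable (pick S) := by
  by_cases h : S.Nonempty
  · let g : ℤ → V d := fun z => (S.equivFin.symm ⟨z.toNat % S.card,
      Nat.mod_lt _ (Finset.card_pos.mpr h)⟩).val
    have e : pick S = g ∘ fun u : ℝ => ⌊u * S.card⌋ := by
      funext u
      simp [pick, h, g]
    rw [e]
    exact (measurable_of_countable g).comp (Int.measurable_floor.comp (measurable_id.mul_const _))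
  · have e : pick S = fun _ => 0 := by
      funext u
      simp [pick, h]
    rw [e]; exact measurable_const

theorem pick_mem {S : Finset (V d)} (h : S.Nonempty) (u : ℝ) : pick S u ∈ S := by
  simp [pick, h]

theorem pick_prob {S : Finset (V d)} {x : V d} (hx : x ∈ S) :
    μ0 {u | pick S u = x} = (S.card : ℝ≥0∞)⁻¹ := by
  have h : S.Nonempty := ⟨x, hx⟩
  have hc : 0 < S.card := Finset.card_pos.2 h
  have hcr : (0:ℝ) < S.card := by exact_mod_cast hc
  set k : Fin S.card := S.equivFin ⟨x, hx⟩ with hk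
  have h1 : {u | pick S u = x} =ᵐ[μ0]
      Set.Ico ((k : ℝ) / S.card) ((k + 1 : ℝ) / S.card) := by
    filter_upwards [ae_Ico] with u hu
    apply propext
    change pick S u = x ↔ _ ≤ _ ∧ _ < _
    rw [div_le_iff₀ hcr, lt_div_iff₀ hcr]
    have h0 : 0 ≤ ⌊u * S.card⌋ := Int.floor_nonneg.2 (mul_nonneg hu.1 hcr.le)
    have h2 : ⌊u * S.card⌋ < S.card := by
      rw [Int.floor_lt]; push_cast; nlinarith [hu.2]
    have h3 : (⌊u * S.card⌋).toNat % S.card = (⌊u * S.card⌋).toNat :=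
      Nat.mod_eq_of_lt (by omega)
    have h4 : pick S u = x ↔ (⌊u * S.card⌋).toNat = k := by
      simp only [pick, h, dif_pos]
      conv_rhs => rw [← h3]
      constructor
      · intro h5
        rw [hk]
        have : (⟨x, hx⟩ : S) = S.equivFin.symm ⟨(⌊u * S.card⌋).toNat % S.card, Nat.mod_lt _ hc⟩ :=
          Subtype.ext h5.symm
        rw [this]; simp
      · intro h5
        have : (⟨(⌊u * S.card⌋).toNat % S.card, Nat.mod_lt _ hc⟩ : Fin S.card) = k := Fin.ext h5
        rw [this, hk]; simp
    rw [h4]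
    have h5 : (⌊u * S.card⌋).toNat = k ↔ ⌊u * S.card⌋ = ((k : ℕ) : ℤ) := by omega
    rw [h5, Int.floor_eq_iff]
    simp
  rw [measure_congr h1, μ0_eq, Measure.restrict_apply measurableSet_Ico,
    Set.inter_eq_left.2, Real.volume_Ico]
  · rw [← sub_div, add_sub_cancel_left, one_div, ENNReal.ofReal_inv_of_pos hcr]
    simp
  · intro u hu
    refine ⟨le_trans (by positivity) hu.1, hu.2.trans_le ?_⟩
    rw [div_le_one hcr]
    have := k.2
    exact_mod_cast this

/-- walk from a step sequence -/
def sw (x : V d) (s : ℕ → V d) (t : ℕ) : V d := x + ∑ i ∈ Finset.range t, s i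

noncomputable def sh (S : Finset (V d)) (x : V d) (s : ℕ → V d) : V d :=
  sw x s (sInf {t | sw x s t ∉ S})

noncomputable def stp (d : ℕ) (ω : ℝ) : ℕ → V d := fun i => pick (unitVecs d) (uSlice ω i)

theorem hitPt_eq (S : Finset (V d)) (x : V d) (ω : ℝ) : hitPt S x ω = sh S x (stp d ω) := rfl

theorem sh_iff {S : Finset (V d)} {y : V d} (hy : y ∉ S) (x : V d) (s : ℕ → V d) :
    sh S x s = y ↔ ∃ t, sw x s t = y ∧ ∀ k < t, sw x s k ∈ S := by
  constructor
  · intro h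
    refine ⟨_, h, fun k hk => ?_⟩
    have := Nat.notMem_of_lt_sInf hk
    simpa using this
  · rintro ⟨t, ht, hk⟩
    have hm : t ∈ {t | sw x s t ∉ S} := by
      change sw x s t ∉ S
      rw [ht]; exact hy
    have e : sInf {t | sw x s t ∉ S} = t := by
      refine le_antisymm (Nat.sInf_le hm) ?_
      by_contra hlt
      push Not at hlt
      exact (Nat.sInf_mem ⟨t, hm⟩) (hk _ hlt)
    rw [sh, e, ht]

theorem sh_mem_iff {S : Finset (V d)} {y : V d} (hy : y ∈ S) (x : V d) (s : ℕ → V d) :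
    sh S x s = y ↔ (∀ t, sw x s t ∈ S) ∧ x = y := by
  constructor
  · intro h
    have h1 : ∀ t, sw x s t ∈ S := by
      by_contra hc
      push Not at hc
      have : sInf {t | sw x s t ∉ S} ∈ {t | sw x s t ∉ S} := Nat.sInf_mem hc
      have h2 : sh S x s ∉ S := this
      exact h2 (h ▸ hy)
    refine ⟨h1, ?_⟩
    have e : {t | sw x s t ∉ S} = ∅ := by
      ext t; simp [h1 t]
    rw [← h, sh, e]; simp [sw]
  · rintro ⟨h1, rfl⟩
    have e : {t | sw x s t ∉ S} = ∅ := by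
      ext t; simp [h1 t]
    rw [sh, e]; simp [sw]

theorem measurable_sw (x : V d) (t : ℕ) : Measurable (fun s => sw x s t) := by
  unfold sw
  exact measurable_const.add (Finset.measurable_sum _ fun i _ => measurable_pi_apply i)

theorem measurable_sh (S : Finset (V d)) (x : V d) : Measurable (sh S x) := by
  refine measurable_to_countable' (fun y => ?_)
  by_cases hy : y ∈ S
  · have : sh S x ⁻¹' {y} = (⋂ t, (fun s => sw x s t) ⁻¹' S) ∩ {_s | x = y} := by
      ext s
      simp only [Set.mem_preimage, Set.mem_singleton_iff, sh_mem_iff hy, Set.mem_inter_iff,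
        Set.mem_iInter]
      rfl
    rw [this]
    exact (MeasurableSet.iInter fun t => measurable_sw x t S.measurableSet).inter
      (MeasurableSet.const _)
  · have : sh S x ⁻¹' {y} = ⋃ t, ((fun s => sw x s t) ⁻¹' {y} ∩
        ⋂ k, ⋂ (_ : k < t), (fun s => sw x s k) ⁻¹' S) := by
      ext s
      simp only [Set.mem_preimage, Set.mem_singleton_iff, sh_iff hy, Set.mem_inter_iff,
        Set.mem_iInter, Set.mem_iUnion]
      rfl
    rw [this]
    exact MeasurableSet.iUnion fun t => (measurable_sw x t (measurableSet_singleton _)).inter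
      (MeasurableSet.iInter fun k => MeasurableSet.iInter fun _ =>
        measurable_sw x k S.measurableSet)

theorem measurable_stp : Measurable (stp d) :=
  measurable_pi_lambda _ fun i => (measurable_pick _).comp (measurable_uSlice i)

theorem measurable_hitPt (S : Finset (V d)) (x : V d) : Measurable (hitPt S x) :=
  (measurable_sh S x).comp measurable_stp

noncomputable def ρ (d : ℕ) : Measure (V d) := μ0.map (pick (unitVecs d))

instance : IsProbabilityMeasure (ρ d) :=
  Measure.isProbabilityMeasure_map (measurable_pick _).aemeasurable

noncomputable abbrev W (d : ℕ) : Measure (ℕ → V d) := Measure.infinitePi (fun _ : ℕ => ρ d)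

theorem map_stp : μ0.map (stp d) = W d := by
  have e : stp d = (fun (u : ℕ → ℝ) i => pick (unitVecs d) (u i)) ∘ (fun x i => uSlice x i) := rfl
  have m1 : Measurable (fun (u : ℕ → ℝ) i => pick (unitVecs d) (u i)) :=
    measurable_pi_lambda _ fun i => (measurable_pick _).comp (measurable_pi_apply i)
  rw [e, ← Measure.map_map m1 measurable_slices, map_slices, Measure.infinitePi_map_pi]
  · rfl
  · intro i; exact measurable_pick _

theorem hitProb_eq (S : Finset (V d)) (x y : V d) : hitProb S x y = W d {s | sh S x s = y} := by
  have ms : MeasurableSet {s | sh S x s = y} := measurable_sh S x (measurableSet_singleton y)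
  rw [← map_stp, Measure.map_apply measurable_stp ms]
  rfl

def scons (p : V d × (ℕ → V d)) : ℕ → V d := fun i => Nat.casesOn i p.1 p.2

theorem measurable_scons : Measurable (scons (d := d)) := by
  refine measurable_pi_lambda _ fun i => ?_
  cases i with
  | zero => exact measurable_fst
  | succ i => exact (measurable_pi_apply i).comp measurable_snd

theorem map_scons : ((ρ d).prod (W d)).map scons = W d := by
  refine Measure.eq_infinitePi _ (fun s t ht => ?_)
  obtain ⟨n, hn⟩ : ∃ n, ∀ i ∈ s, i < n + 1 := ⟨s.sup id, fun i hi =>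
    Nat.lt_succ_of_le (Finset.le_sup (f := id) hi)⟩
  classical
  let t' : ℕ → Set (V d) := fun i => if i ∈ s then t i else Set.univ
  have e1 : Set.pi s t = Set.pi (Finset.range (n+1)) t' := by
    ext a
    simp only [Set.mem_pi, Finset.mem_coe, Finset.mem_range, t']
    constructor
    · intro h i _
      by_cases hi : i ∈ s
      · simp [hi, h i hi]
      · simp [hi]
    · intro h i hi
      simpa [hi] using h i (hn i hi)
  have e2 : ∏ i ∈ s, (ρ d) (t i) = ∏ i ∈ Finset.range (n+1), (ρ d) (t' i) := by
    rw [← Finset.prod_subset (s₁ := s) (fun i hi => Finset.mem_range.2 (hn i hi))]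
    · exact Finset.prod_congr rfl fun i hi => by simp [t', hi]
    · intro i _ hi; simp [t', hi]
  have mt' : ∀ i, MeasurableSet (t' i) := fun i => (Set.to_countable _).measurableSet
  have e3 : scons ⁻¹' (Set.pi (Finset.range (n+1)) t') =
      t' 0 ×ˢ Set.pi (Finset.range n) (fun i => t' (i+1)) := by
    ext ⟨e, a⟩
    simp only [Set.mem_preimage, Set.mem_pi, Finset.mem_coe, Finset.mem_range, Set.mem_prod]
    constructor
    · intro h
      exact ⟨h 0 (by omega), fun i hi => h (i+1) (by omega)⟩
    · rintro ⟨h1, h2⟩ i hi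
      cases i with
      | zero => exact h1
      | succ i => exact h2 i (by omega)
  rw [e1, e2, Measure.map_apply measurable_scons
    (MeasurableSet.pi (Finset.countable_toSet _) fun i _ => mt' i), e3, Measure.prod_prod,
    Measure.infinitePi_pi _ (fun i _ => mt' (i+1)), Finset.prod_range_succ', mul_comm]

theorem sw_scons (x e : V d) (s : ℕ → V d) (t : ℕ) :
    sw x (scons (e, s)) (t+1) = sw (x + e) s t := by
  unfold sw
  rw [Finset.sum_range_succ', add_assoc, add_comm e]
  rfl

theorem sh_scons {S : Finset (V d)} {x y : V d} (hx : x ∈ S) (hy : y ∉ S) (e : V d)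
    (s : ℕ → V d) : sh S x (scons (e, s)) = y ↔ sh S (x + e) s = y := by
  rw [sh_iff hy, sh_iff hy]
  have h0 : ∀ s, sw x s 0 = x := fun s => by simp [sw]
  constructor
  · rintro ⟨t, ht, hk⟩
    cases t with
    | zero => rw [h0] at ht; exact absurd hx (ht ▸ hy)
    | succ t =>
      rw [sw_scons] at ht
      refine ⟨t, ht, fun k hkt => ?_⟩
      rw [← sw_scons]; exact hk _ (by omega)
  · rintro ⟨t, ht, hk⟩
    refine ⟨t+1, by rw [sw_scons, ht], fun k hkt => ?_⟩
    cases k with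
    | zero => rw [h0]; exact hx
    | succ k => rw [sw_scons]; exact hk k (by omega)

theorem unitVecs_inj : Function.Injective (fun (p : Fin d × Bool) => (fun j =>
    if j = p.1 then (if p.2 then 1 else -1) else 0 : V d)) := by
  rintro ⟨i, b⟩ ⟨j, c⟩ h
  have h1 := congrFun h i
  by_cases hij : i = j
  · subst hij
    simp at h1
    cases b <;> cases c <;> simp_all
  · simp [hij] at h1
    cases b <;> simp at h1

theorem card_unitVecs : (unitVecs d).card = d * 2 := by
  rw [unitVecs, Finset.card_image_of_injective _ unitVecs_inj]
  simp

theorem ρ_eq (hd : 1 ≤ d) :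
    ρ d = ∑ e ∈ unitVecs d, ((d * 2 : ℕ) : ℝ≥0∞)⁻¹ • Measure.dirac e := by
  have hne : (unitVecs d).Nonempty := Finset.card_pos.1 (by rw [card_unitVecs]; omega)
  refine Measure.ext_of_singleton fun y => ?_
  rw [ρ, Measure.map_apply (measurable_pick _) (measurableSet_singleton _),
    Measure.finsetSum_apply]
  by_cases hy : y ∈ unitVecs d
  · change μ0 {u | pick (unitVecs d) u = y} = _
    rw [pick_prob hy, card_unitVecs, Finset.sum_eq_single y]
    · simp
    · intro b _ hb; simp [hb]
    · intro h; exact absurd hy h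
  · have : pick (unitVecs d) ⁻¹' {y} = ∅ := by
      ext u
      simp only [Set.mem_preimage, Set.mem_singleton_iff, Set.mem_empty_iff_false, iff_false]
      intro h
      exact hy (h ▸ pick_mem hne u)
    rw [this, measure_empty, eq_comm, Finset.sum_eq_zero]
    intro e he
    have : e ≠ y := fun h => hy (h ▸ he)
    simp [this]

theorem hitProb_harm (hd : 1 ≤ d) {S : Finset (V d)} {x y : V d} (hx : x ∈ S) (hy : y ∉ S) :
    hitProb S x y = ∑ e ∈ unitVecs d, ((d * 2 : ℕ) : ℝ≥0∞)⁻¹ * hitProb S (x + e) y := by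
  have ms : ∀ z, MeasurableSet {s | sh S z s = y} := fun z =>
    measurable_sh S z (measurableSet_singleton y)
  simp_rw [hitProb_eq]
  conv_lhs => rw [← map_scons]
  rw [Measure.map_apply measurable_scons (ms x), Measure.prod_apply (measurable_scons (ms x)),
    ρ_eq hd, lintegral_finsetSum_measure]
  refine Finset.sum_congr rfl fun e _ => ?_
  rw [lintegral_smul_measure, lintegral_dirac, smul_eq_mul]
  congr 2
  ext s
  exact sh_scons hx hy e s

theorem hitProb_le (S : Finset (V d)) (x y : V d) : hitProb S x y ≤ 1 := prob_le_one

theorem hitProb_L (hd : 1 ≤ d) {S : Finset (V d)} {x y : V d} (hx : x ∈ S) (hy : y ∉ S) :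
    L (fun z => (hitProb S z y).toReal) x = 0 := by
  have hf : ∀ z, hitProb S z y ≠ ∞ := fun z => ((hitProb_le S z y).trans_lt ENNReal.one_lt_top).ne
  have h := congrArg ENNReal.toReal (hitProb_harm hd hx hy)
  rw [ENNReal.toReal_sum (fun e _ => ENNReal.mul_ne_top (by simp; omega) (hf _))] at h
  simp only [ENNReal.toReal_mul, ENNReal.toReal_inv, ENNReal.toReal_natCast] at h
  rw [← Finset.mul_sum, unitVecs, Finset.sum_image (fun a _ b _ hab => unitVecs_inj hab),
    ← Finset.univ_product_univ, Finset.sum_product] at h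
  have e1 : ∀ i : Fin d, (fun j => if j = i then 1 else 0 : V d)
      = sv i := by
    intro i; funext j; simp [sv, Pi.single_apply]
  have e2 : ∀ i : Fin d, (fun j => if j = i then (if false = true then 1 else -1) else 0 : V d)
      = - sv i := by
    intro i; funext j; simp [sv, Pi.single_apply]; split_ifs <;> simp
  simp only [Fintype.sum_bool, e2, ← sub_eq_add_neg, if_true, e1] at h
  unfold L
  rw [Finset.sum_sub_distrib]
  have hd' : (0:ℝ) < d := by exact_mod_cast hd
  simp only [Finset.sum_const, Finset.card_univ, Fintype.card_fin, nsmul_eq_mul]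
  push_cast at h
  field_simp at h
  linarith

end UIDLA

namespace UIDLA
variable {d : ℕ}

instance : DiscreteMeasurableSpace (Finset (V d)) := ⟨fun _ => trivial⟩

theorem prob_ext_off {α : Type*} [MeasurableSpace α] [DiscreteMeasurableSpace α] [Countable α]
    (μ ν : Measure α) [IsProbabilityMeasure μ] [IsProbabilityMeasure ν] (a : α)
    (h : ∀ b, b ≠ a → μ {b} = ν {b}) : μ = ν := by
  have h1 : μ.restrict {a}ᶜ = ν.restrict {a}ᶜ := by
    refine Measure.ext_of_singleton fun b => ?_
    rw [Measure.restrict_apply (measurableSet_singleton _),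
      Measure.restrict_apply (measurableSet_singleton _)]
    by_cases hb : b = a
    · simp [hb]
    · have : ({b} : Set α) ∩ {a}ᶜ = {b} := by
        rw [Set.inter_eq_left]; simpa using Ne.symm hb
      rw [this, h b hb]
  have h2 : μ {a}ᶜ = ν {a}ᶜ := by
    have := congrArg (fun m => m Set.univ) h1
    simpa using this
  refine Measure.ext_of_singleton fun b => ?_
  by_cases hb : b = a
  · subst hb
    have e1 := prob_compl_eq_one_sub (μ := μ) (s := {b}ᶜ) (MeasurableSet.of_discrete)
    have e2 := prob_compl_eq_one_sub (μ := ν) (s := {b}ᶜ) (MeasurableSet.of_discrete)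
    rw [compl_compl] at e1 e2
    rw [e1, e2, h2]
  · exact h b hb

theorem thin (X Y : ℝ → Finset (V d)) (hX : Measurable X) (hY : Measurable Y)
    (S : Finset (V d)) (hYX : ∀ ω, Y ω ⊆ X ω) (hSX : ∀ ω, S ⊆ X ω)
    (ν : Measure (Finset (V d))) [IsProbabilityMeasure ν]
    (hν : ∀ A, A ≠ S → ν {A} ≤ μ0 {ω | Y ω = A}) : StochDom (μ0.map X) ν := by
  classical
  set J : Measure (Finset (V d) × Finset (V d)) := μ0.map (fun ω => (X ω, Y ω)) with hJ
  have hXY : Measurable (fun ω => (X ω, Y ω)) := hX.prodMk hY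
  have hJp : IsProbabilityMeasure J := Measure.isProbabilityMeasure_map hXY.aemeasurable
  set θ : Finset (V d) → ℝ≥0∞ := fun A => if A = S then 1 else ν {A} / μ0 {ω | Y ω = A} with hθ
  have hθ1 : ∀ A, θ A ≤ 1 := by
    intro A
    by_cases hA : A = S
    · simp [hθ, hA]
    · simp only [hθ, hA, if_false]
      exact ENNReal.div_le_of_le_mul (by simpa using hν A hA)
  set f : Finset (V d) × Finset (V d) → ℝ≥0∞ := fun p => θ p.2
  set g : Finset (V d) × Finset (V d) → ℝ≥0∞ := fun p => 1 - θ p.2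
  set r : Finset (V d) × Finset (V d) → Finset (V d) × Finset (V d) := fun p => (p.1, S)
  have hr : Measurable r := Measurable.of_discrete
  have hf : Measurable f := Measurable.of_discrete
  have hg : Measurable g := Measurable.of_discrete
  set π : Measure (Finset (V d) × Finset (V d)) :=
    J.withDensity f + (J.withDensity g).map r with hπ
  have hfg : J.withDensity f + J.withDensity g = J := by
    rw [← withDensity_add_left hf]
    have : f + g = 1 := by
      funext p
      exact add_tsub_cancel_of_le (hθ1 p.2)
    rw [this, withDensity_one]
  have hfst : π.map Prod.fst = μ0.map X := by
    rw [hπ, Measure.map_add _ _ measurable_fst, Measure.map_map measurable_fst hr]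
    have : Prod.fst ∘ r = Prod.fst := rfl
    rw [this, ← Measure.map_add _ _ measurable_fst, hfg, hJ, Measure.map_map measurable_fst hXY]
    rfl
  have hπp : IsProbabilityMeasure π := by
    constructor
    have h1 : (π.map Prod.fst) Set.univ = 1 := by
      rw [hfst]
      have := Measure.isProbabilityMeasure_map (μ := μ0) hX.aemeasurable
      exact measure_univ
    rwa [Measure.map_apply measurable_fst MeasurableSet.univ, Set.preimage_univ] at h1
  have hsndp : IsProbabilityMeasure (π.map Prod.snd) :=
    Measure.isProbabilityMeasure_map measurable_snd.aemeasurable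
  refine ⟨π, hπp, hfst, ?_, ?_⟩
  · refine prob_ext_off _ _ S (fun A hA => ?_)
    rw [Measure.map_apply measurable_snd (measurableSet_singleton _), hπ, Measure.add_apply,
      Measure.map_apply hr MeasurableSet.of_discrete]
    have e1 : r ⁻¹' (Prod.snd ⁻¹' {A}) = ∅ := by
      ext p
      simp only [Set.mem_preimage, Set.mem_singleton_iff, Set.mem_empty_iff_false, iff_false, r]
      exact fun h => hA h.symm
    rw [e1, measure_empty, add_zero, withDensity_apply _ MeasurableSet.of_discrete]
    have e2 : ∫⁻ p in Prod.snd ⁻¹' {A}, f p ∂J = ∫⁻ p in Prod.snd ⁻¹' {A}, θ A ∂J := by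
      refine setLIntegral_congr_fun MeasurableSet.of_discrete (fun p hp => ?_)
      simp only [Set.mem_preimage, Set.mem_singleton_iff] at hp
      simp [f, hp]
    have e3 : J (Prod.snd ⁻¹' {A}) = μ0 {ω | Y ω = A} := by
      rw [hJ, Measure.map_apply hXY MeasurableSet.of_discrete]; rfl
    rw [e2, setLIntegral_const, e3]
    simp only [hθ, hA, if_false]
    refine ENNReal.div_mul_cancel' ?_ ?_
    · intro h0
      have := hν A hA
      rw [h0] at this
      exact le_antisymm this bot_le
    · intro h; exact absurd h (measure_ne_top _ _)
  · rw [← prob_compl_eq_zero_iff MeasurableSet.of_discrete, hπ, Measure.add_apply, add_eq_zero]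
    constructor
    · refine withDensity_absolutelyContinuous J f ?_
      rw [hJ, Measure.map_apply hXY MeasurableSet.of_discrete]
      convert measure_empty (μ := μ0)
      ext ω
      simp only [Set.mem_preimage, Set.mem_compl_iff, Set.mem_empty_iff_false, iff_false, not_not]
      exact hYX ω
    · rw [Measure.map_apply hr MeasurableSet.of_discrete]
      refine withDensity_absolutelyContinuous J g ?_
      rw [hJ, Measure.map_apply hXY MeasurableSet.of_discrete]
      convert measure_empty (μ := μ0)
      ext ω
      simp only [Set.mem_preimage, Set.mem_compl_iff, Set.mem_empty_iff_false, iff_false, not_not]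
      exact hSX ω

theorem map_uSlice (i : ℕ) : μ0.map (fun ω => uSlice ω i) = μ0 := by
  have h : (fun ω => uSlice ω i) = (fun u : ℕ → ℝ => u i) ∘ (fun x i => uSlice x i) := rfl
  rw [h, ← Measure.map_map (measurable_pi_apply i) measurable_slices, map_slices,
    Measure.infinitePi_map_eval]

theorem map_pair : μ0.map (fun ω => (uSlice ω 0, uSlice ω 1)) = μ0.prod μ0 := by
  have h : (fun ω => (uSlice ω 0, uSlice ω 1)) = (fun u : ℕ → ℝ => (u 0, u 1)) ∘
    (fun x i => uSlice x i) := rfl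
  rw [h, ← Measure.map_map (by fun_prop) measurable_slices, map_slices,
    Measure.infinitePi_map_eval_prod (by norm_num)]

theorem measurable_addPt (S : Finset (V d)) (x : V d) : Measurable (addPt S x) :=
  (Measurable.of_discrete (f := fun y : V d => insert y S)).comp (measurable_hitPt S x)

theorem measurable_addPt_comp (R : Finset (V d)) {x : ℝ → V d} {z : ℝ → ℝ} (mx : Measurable x)
    (mz : Measurable z) : Measurable (fun ω => addPt R (x ω) (z ω)) := by
  let F : V d × ℝ → Finset (V d) := fun p => addPt R p.1 p.2
  have : Measurable F :=
    measurable_from_prod_countable_right (fun w => measurable_addPt R w)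
  exact Measurable.comp (g := F) this (mx.prodMk mz)

theorem addPt_mono {S T : Finset (V d)} (hST : S ⊆ T) (x : V d) (ω : ℝ) :
    addPt S x ω ⊆ addPt T x ω := by
  unfold addPt
  refine Finset.insert_subset ?_ (hST.trans (Finset.subset_insert _ _))
  by_cases hy : hitPt S x ω ∈ T
  · exact Finset.mem_insert_of_mem hy
  · have hyS : hitPt S x ω ∉ S := fun h => hy (hST h)
    obtain ⟨t, h1, h2⟩ := (sh_iff hyS x (stp d ω)).1 rfl
    have : hitPt T x ω = hitPt S x ω := (sh_iff hy x (stp d ω)).2 ⟨t, h1, fun k hk => hST (h2 k hk)⟩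
    rw [this]; exact Finset.mem_insert_self _ _

theorem addPt_eq_iff {S : Finset (V d)} {y : V d} (hy : y ∉ S) (x : V d) (ω : ℝ) :
    addPt S x ω = insert y S ↔ hitPt S x ω = y := by
  unfold addPt
  constructor
  · intro h
    have : y ∈ insert (hitPt S x ω) S := h ▸ Finset.mem_insert_self _ _
    rcases Finset.mem_insert.1 this with h | h
    · exact h.symm
    · exact absurd h hy
  · intro h; rw [h]

end UIDLA

open UIDLA in
theorem statement3 (d : ℕ) (hd : 2 ≤ d) :
    ∃ C : ℝ, 0 < C ∧ ∃ N : ℕ, ∀ n : ℕ, N ≤ n →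
      ∀ S T : Finset (V d), ball d n ⊆ S → S ⊆ T →
        StochDom (uLaw T 1)
          (ENNReal.ofReal ((bn d n : ℝ) / T.card * (1 - C / n)) • daLaw S [(0 : V d)]
            + (1 - ENNReal.ofReal ((bn d n : ℝ) / T.card * (1 - C / n))) •
                Measure.dirac S) := by
  have hd1 : 1 ≤ d := by omega
  obtain ⟨C, hC, N, hN⟩ := analytic (d := d) hd1
  refine ⟨C, hC, N, fun n hn S T hBS hST => ?_⟩
  have h0B : (0 : V d) ∈ ball d n := by
    rw [mem_ball, nq_zero]; positivity
  have hTne : T.Nonempty := ⟨0, hST (hBS h0B)⟩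
  have hTc : (0:ℝ) < T.card := by exact_mod_cast Finset.card_pos.2 hTne
  set a : ℝ := (bn d n : ℝ) / T.card * (1 - C / n) with ha
  have ha1 : a ≤ 1 := by
    have h1 : (bn d n : ℝ) / T.card ≤ 1 := by
      rw [div_le_one hTc]
      exact_mod_cast Finset.card_le_card (hBS.trans hST)
    have h2 : 0 ≤ C / n := by positivity
    have h3 : 0 ≤ (bn d n : ℝ) / T.card := by positivity
    rw [ha]; nlinarith
  have hp1 : ENNReal.ofReal a ≤ 1 := by simpa using ha1
  have hda : daLaw S [(0 : V d)] = μ0.map (addPt S 0) := by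
    have e : (fun ω => daFrom S [(0 : V d)] ω) = addPt S 0 ∘ (fun ω => uSlice ω 0) := rfl
    rw [daLaw, e, ← Measure.map_map (measurable_addPt S 0) (measurable_uSlice 0), map_uSlice]
  have hdap : IsProbabilityMeasure (daLaw S [(0 : V d)]) := by
    rw [hda]; exact Measure.isProbabilityMeasure_map (measurable_addPt S 0).aemeasurable
  have hνp : IsProbabilityMeasure (ENNReal.ofReal a • daLaw S [(0 : V d)]
            + (1 - ENNReal.ofReal a) • Measure.dirac S) := by
    constructor
    rw [Measure.add_apply, Measure.smul_apply, Measure.smul_apply, measure_univ, measure_univ,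
      smul_eq_mul, smul_eq_mul, mul_one, mul_one, add_tsub_cancel_of_le hp1]
  let x : ℝ → V d := fun ω => pick T (uSlice (uSlice ω 0) 0)
  let z : ℝ → ℝ := fun ω => uSlice (uSlice ω 0) 1
  have mx : Measurable x := (measurable_pick T).comp ((measurable_uSlice 0).comp (measurable_uSlice 0))
  have mz : Measurable z := (measurable_uSlice 1).comp (measurable_uSlice 0)
  have mA : ∀ R : Finset (V d), Measurable (fun ω => addPt R (x ω) (z ω)) := by
    intro R
    exact measurable_addPt_comp R mx mz
  classical
  let Y : ℝ → Finset (V d) := fun ω => if x ω ∈ ball d n then addPt S (x ω) (z ω) else S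
  have mxb : MeasurableSet {ω | x ω ∈ ball d n} := mx (ball d n).measurableSet
  have mY : Measurable Y := Measurable.ite mxb (mA S) measurable_const
  have hmap : μ0.map (fun ω => (uSlice (uSlice ω 0) 0, z ω)) = μ0.prod μ0 := by
    have e : (fun ω => (uSlice (uSlice ω 0) 0, z ω)) =
      (fun ω => (uSlice ω 0, uSlice ω 1)) ∘ (fun ω => uSlice ω 0) := rfl
    rw [e, ← Measure.map_map ((measurable_uSlice 0).prodMk (measurable_uSlice 1))
      (measurable_uSlice 0), map_uSlice, map_pair]
  have e : uLaw T 1 = μ0.map (fun ω => addPt T (x ω) (z ω)) := rfl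
  rw [e]
  refine thin (fun ω => addPt T (x ω) (z ω)) Y (mA T) mY S (fun ω => ?_) (fun ω => ?_) _ (fun A hA => ?_)
  · by_cases hx : x ω ∈ ball d n
    · simp only [Y, hx, if_true]; exact addPt_mono hST _ _
    · simp only [Y, hx, if_false]; exact hST.trans (Finset.subset_insert _ _)
  · exact hST.trans (Finset.subset_insert _ _)
  · have hS0 : (Measure.dirac S : Measure (Finset (V d))) {A} = 0 := by
      simp [Ne.symm hA]
    rw [Measure.add_apply, Measure.smul_apply, Measure.smul_apply, hS0, smul_zero, add_zero,
      smul_eq_mul, hda, Measure.map_apply (measurable_addPt S 0) (measurableSet_singleton _)]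
    by_cases hex : ∃ y, y ∉ S ∧ A = insert y S
    · obtain ⟨y, hy, rfl⟩ := hex
      have h1 : addPt S 0 ⁻¹' {insert y S} = {ω | hitPt S 0 ω = y} := by
        ext ω; exact addPt_eq_iff hy 0 ω
      rw [h1]
      change ENNReal.ofReal a * hitProb S 0 y ≤ _
      have h2 : {ω | Y ω = insert y S} = ⋃ w ∈ ball d n, (fun ω => (uSlice (uSlice ω 0) 0, z ω)) ⁻¹'
          ({u | pick T u = w} ×ˢ {v | hitPt S w v = y}) := by
        ext ω
        simp only [Set.mem_iUnion]
        change Y ω = insert y S ↔ ∃ w, ∃ _ : w ∈ ball d n, x ω = w ∧ hitPt S w (z ω) = y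
        by_cases hx : x ω ∈ ball d n
        · simp only [Y, hx, if_true, addPt_eq_iff hy]
          constructor
          · intro h; exact ⟨x ω, hx, rfl, h⟩
          · rintro ⟨w, _, rfl, h⟩; exact h
        · simp only [Y, hx, if_false]
          constructor
          · intro h; exact absurd h.symm hA
          · rintro ⟨w, hw, h, _⟩; exact absurd (h ▸ hw) hx
      have mprod : ∀ w, MeasurableSet ({u | pick T u = w} ×ˢ {v | hitPt S w v = y}) := fun w =>
        MeasurableSet.prod (measurable_pick T (measurableSet_singleton w))
          (measurable_hitPt S w (measurableSet_singleton y))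
      have mf : Measurable (fun ω => (uSlice (uSlice ω 0) 0, z ω)) :=
        ((measurable_uSlice 0).comp (measurable_uSlice 0)).prodMk mz
      rw [h2, measure_biUnion_finset]
      · have h3 : ∀ w ∈ ball d n, μ0 ((fun ω => (uSlice (uSlice ω 0) 0, z ω)) ⁻¹'
          ({u | pick T u = w} ×ˢ {v | hitPt S w v = y})) =
            ENNReal.ofReal ((hitProb S w y).toReal / T.card) := by
          intro w hw
          rw [← Measure.map_apply mf (mprod w), hmap, Measure.prod_prod,
            pick_prob (hST (hBS hw)), ENNReal.ofReal_div_of_pos hTc, ENNReal.ofReal_natCast,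
            ENNReal.ofReal_toReal ((hitProb_le S w y).trans_lt ENNReal.one_lt_top).ne, mul_comm]
          rfl
        rw [Finset.sum_congr rfl h3, ← ENNReal.ofReal_sum_of_nonneg (fun w _ => by positivity),
          ← ENNReal.ofReal_toReal ((hitProb_le S 0 y).trans_lt ENNReal.one_lt_top).ne,
          ← ENNReal.ofReal_mul' ENNReal.toReal_nonneg]
        refine ENNReal.ofReal_le_ofReal ?_
        have h4 := hN n hn (fun w => (hitProb S w y).toReal) (fun w => ENNReal.toReal_nonneg)
          (fun w hw => hitProb_L hd1 (hBS hw) hy)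
        rw [← Finset.sum_div, le_div_iff₀ hTc]
        have h5 : a * (hitProb S 0 y).toReal * T.card =
            (bn d n : ℝ) * (1 - C / n) * (hitProb S 0 y).toReal := by
          rw [ha]; field_simp
        rw [h5]; exact h4
      · intro w _ w' _ hww
        refine Set.disjoint_left.2 fun ω h1 h2 => hww ?_
        have h1' : x ω = w := h1.1
        have h2' : x ω = w' := h2.1
        rw [← h1', h2']
      · intro w _; exact mf (mprod w)
    · have h1 : addPt S 0 ⁻¹' {A} = ∅ := by
        ext ω
        simp only [Set.mem_preimage, Set.mem_singleton_iff, Set.mem_empty_iff_false, iff_false]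
        intro h
        apply hex
        refine ⟨hitPt S 0 ω, fun hm => hA ?_, h.symm⟩
        rw [← h, addPt, Finset.insert_eq_of_mem hm]
      rw [h1, measure_empty, mul_zero]
      exact bot_le
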